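/- arXiv:2501.06889 — 2 statements merged into one kernel-verified Lean document; each statement's English description precedes it below -/
import Mathlib

section
/- There exists a constant C > 0 such that for every integer a ≥ 8 and every real number x ≥ 1, the number of integers w ≥ 1 with Nm((⌊−(a+1)·w/(a² + 3a + 3)⌋ + 1) − w·ρ + (⌊(a+2)·w/(a² + 3a + 3)⌋ + 1)·ρ²) ≤ x is at most C·((log a)²·x/a² + (x/a)^(2/3)). -/
open NumberField

/-- The largest real root of `X³ - aX² - (a+3)X - 1` (for `a ≥ 7` this set of real roots
is nonempty and bounded above, so `sSup` picks out the largest root). -/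
noncomputable def simplestCubicRoot (a : ℤ) : ℝ :=
  sSup {x : ℝ | x ^ 3 - (a : ℝ) * x ^ 2 - ((a : ℝ) + 3) * x - 1 = 0}


/-- Triples of positive integers with product at most `Z`, the first two at most `n`. -/
def boundedTriples (n : ℕ) (Z : ℝ) : Set (ℕ × ℕ × ℕ) :=
  {t | t.1 ∈ Finset.Icc 1 n ∧ t.2.1 ∈ Finset.Icc 1 n ∧ 1 ≤ t.2.2 ∧
    (t.1 * t.2.1 * t.2.2 : ℝ) ≤ Z}

/-- Pairs of positive integers with `p * k * (p + k) ≤ Z`. -/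
def cubicPairs (Z : ℝ) : Set (ℕ × ℕ) :=
  {t | 1 ≤ t.1 ∧ 1 ≤ t.2 ∧ (t.1 * t.2 * (t.1 + t.2) : ℝ) ≤ Z}

lemma boundedTriples_finite_ncard_le (n : ℕ) {Z : ℝ} (hZ : 0 ≤ Z) :
    (boundedTriples n Z).Finite ∧
      ((boundedTriples n Z).ncard : ℝ) ≤ Z * (∑ i ∈ Finset.Icc 1 n, (i : ℝ)⁻¹) ^ 2 := by
  let A : Finset (Σ _ : ℕ × ℕ, ℕ) :=
    (Finset.Icc 1 n ×ˢ Finset.Icc 1 n).sigma fun t => Finset.Icc 1 ⌊Z / (t.1 * t.2)⌋₊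
  let B : Finset (ℕ × ℕ × ℕ) := A.image fun s => (s.1.1, s.1.2, s.2)
  have hsub : boundedTriples n Z ⊆ B := by
    rintro ⟨p, q, k⟩ ⟨hp, hq, hk, h⟩
    simp only at hp hq hk h
    have hp1 : (0 : ℝ) < p := by exact_mod_cast (Finset.mem_Icc.1 hp).1
    have hq1 : (0 : ℝ) < q := by exact_mod_cast (Finset.mem_Icc.1 hq).1
    simp only [B, Finset.coe_image, Set.mem_image, Finset.mem_coe]
    refine ⟨⟨(p, q), k⟩, ?_, rfl⟩
    simp only [A, Finset.mem_sigma, Finset.mem_product, Finset.mem_Icc] at *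
    refine ⟨⟨hp, hq⟩, hk, Nat.le_floor ?_⟩
    rw [le_div_iff₀ (by positivity)]
    linarith
  refine ⟨B.finite_toSet.subset hsub, ?_⟩
  have h1 : (boundedTriples n Z).ncard ≤ A.card :=
    (Set.ncard_le_ncard hsub B.finite_toSet).trans
      (by rw [Set.ncard_coe_finset]; exact Finset.card_image_le)
  calc ((boundedTriples n Z).ncard : ℝ) ≤ A.card := by exact_mod_cast h1
    _ = ∑ t ∈ Finset.Icc 1 n ×ˢ Finset.Icc 1 n, (⌊Z / (t.1 * t.2)⌋₊ : ℝ) := by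
        simp [A, Finset.card_sigma]
    _ ≤ ∑ t ∈ Finset.Icc 1 n ×ˢ Finset.Icc 1 n, Z * ((t.1 : ℝ)⁻¹ * (t.2 : ℝ)⁻¹) := by
        refine Finset.sum_le_sum fun t _ => (Nat.floor_le (by positivity)).trans (le_of_eq ?_)
        rw [div_eq_mul_inv, mul_inv]
    _ = Z * (∑ i ∈ Finset.Icc 1 n, (i : ℝ)⁻¹) ^ 2 := by
        rw [← Finset.mul_sum, sq, Finset.sum_mul_sum, Finset.sum_product]

lemma sum_inv_sqrt_le (n : ℕ) : ∑ k ∈ Finset.Icc 1 n, (√(k : ℝ))⁻¹ ≤ 2 * √(n : ℝ) := by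
  induction n with
  | zero => simp
  | succ n ih =>
    rw [Finset.sum_Icc_succ_top (by omega)]
    have h0 : (0 : ℝ) < √((n + 1 : ℕ) : ℝ) := Real.sqrt_pos.2 (by positivity)
    have h1 : √((n + 1 : ℕ) : ℝ) ^ 2 = n + 1 := by
      rw [Real.sq_sqrt (by positivity)]; push_cast; ring
    have h2 : √(n : ℝ) ^ 2 = n := Real.sq_sqrt (by positivity)
    have h3 : (√((n + 1 : ℕ) : ℝ))⁻¹ ≤ 2 * √((n + 1 : ℕ) : ℝ) - 2 * √(n : ℝ) := by
      rw [inv_le_iff_one_le_mul₀ h0]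
      nlinarith [sq_nonneg (√((n + 1 : ℕ) : ℝ) - √(n : ℝ))]
    linarith

lemma cubicPairs_finite_ncard_le {Z : ℝ} (hZ : 0 ≤ Z) :
    (cubicPairs Z).Finite ∧ ((cubicPairs Z).ncard : ℝ) ≤ 4 * Z ^ ((2 : ℝ) / 3) := by
  obtain ⟨y, hy, rfl⟩ : ∃ y : ℝ, 0 ≤ y ∧ y ^ 3 = Z :=
    ⟨Z ^ ((1 : ℝ) / 3), by positivity, by rw [← Real.rpow_natCast, ← Real.rpow_mul hZ]; norm_num⟩
  have hy2 : (y ^ 3) ^ ((2 : ℝ) / 3) = y ^ 2 := by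
    rw [← Real.rpow_natCast, ← Real.rpow_natCast, ← Real.rpow_mul hy]; norm_num
  let A : Finset (Σ _ : ℕ, ℕ) :=
    (Finset.Icc 1 ⌊y⌋₊).sigma fun k => Finset.Icc 1 ⌊√(y ^ 3 / k)⌋₊
  let B : Finset (ℕ × ℕ) := A.image (fun s => (s.1, s.2)) ∪ A.image (fun s => (s.2, s.1))
  have key : ∀ k p : ℕ, 1 ≤ k → k ≤ p → (k * p * (k + p) : ℝ) ≤ y ^ 3 →
      (⟨k, p⟩ : Σ _ : ℕ, ℕ) ∈ A := by
    intro k p hk hkp h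
    have hk1 : (0 : ℝ) < k := by exact_mod_cast hk
    have hkp' : (k : ℝ) ≤ p := by exact_mod_cast hkp
    have hp1 : (0 : ℝ) < p := by linarith
    have h1 : (k * p ^ 2 : ℝ) ≤ y ^ 3 := by nlinarith [mul_pos (mul_pos hk1 hk1) hp1]
    simp only [A, Finset.mem_sigma, Finset.mem_Icc]
    refine ⟨⟨hk, Nat.le_floor ?_⟩, hk.trans hkp, Nat.le_floor (Real.le_sqrt_of_sq_le ?_)⟩
    · refine le_of_pow_le_pow_left₀ (n := 3) (by norm_num) hy (le_trans ?_ h1)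
      rw [pow_succ']
      gcongr
    · rw [le_div_iff₀ hk1]
      linarith
  have hsub : cubicPairs (y ^ 3) ⊆ B := by
    rintro ⟨p, k⟩ ⟨hp, hk, h⟩
    simp only at hp hk h
    simp only [B, Finset.coe_union, Finset.coe_image, Set.mem_union, Set.mem_image, Finset.mem_coe]
    rcases le_total p k with hpk | hpk
    · exact Or.inl ⟨_, key p k hp hpk h, rfl⟩
    · exact Or.inr ⟨_, key k p hk hpk (by linarith), rfl⟩
  refine ⟨B.finite_toSet.subset hsub, ?_⟩
  have h1 : (cubicPairs (y ^ 3)).ncard ≤ A.card + A.card :=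
    (Set.ncard_le_ncard hsub B.finite_toSet).trans (by
      rw [Set.ncard_coe_finset]
      exact (Finset.card_union_le _ _).trans
        (add_le_add Finset.card_image_le Finset.card_image_le))
  have h2 : (A.card : ℝ) ≤ 2 * y ^ 2 := by
    calc (A.card : ℝ) = ∑ k ∈ Finset.Icc 1 ⌊y⌋₊, (⌊√(y ^ 3 / k)⌋₊ : ℝ) := by
          simp [A, Finset.card_sigma]
      _ ≤ ∑ k ∈ Finset.Icc 1 ⌊y⌋₊, √(y ^ 3) * (√(k : ℝ))⁻¹ := by
          refine Finset.sum_le_sum fun k _ =>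
            (Nat.floor_le (by positivity)).trans (le_of_eq ?_)
          rw [Real.sqrt_div (by positivity), div_eq_mul_inv]
      _ ≤ √(y ^ 3) * (2 * √y) := by
          rw [← Finset.mul_sum]
          gcongr
          refine (sum_inv_sqrt_le _).trans ?_
          gcongr
          exact Nat.floor_le hy
      _ = 2 * y ^ 2 := by
          rw [mul_left_comm, ← Real.sqrt_mul (by positivity), ← pow_succ,
            show y ^ (3 + 1) = (y ^ 2) ^ 2 by ring, Real.sqrt_sq (by positivity)]
  rw [hy2]
  have h3 : ((cubicPairs (y ^ 3)).ncard : ℝ) ≤ A.card + A.card := by exact_mod_cast h1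
  linarith

lemma sum_inv_le_two_mul_log {n : ℕ} (hn : 8 ≤ n) :
    ∑ i ∈ Finset.Icc 1 (n + 1), (i : ℝ)⁻¹ ≤ 2 * Real.log n := by
  have hn' : (8 : ℝ) ≤ n := by exact_mod_cast hn
  have h1 : Real.log 8 = 3 * Real.log 2 := by
    rw [show (8 : ℝ) = 2 ^ 3 by norm_num, Real.log_pow]; norm_num
  have h2 : Real.log 8 ≤ Real.log n := Real.log_le_log (by norm_num) hn'
  have h3 : Real.log ((n + 1 : ℕ) : ℝ) ≤ Real.log 2 + Real.log n := by
    rw [← Real.log_mul (by norm_num) (by positivity)]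
    refine Real.log_le_log (by positivity) ?_
    push_cast
    linarith
  have h4 := harmonic_le_one_add_log (n + 1)
  rw [harmonic_eq_sum_Icc] at h4
  push_cast at h3 h4
  linarith [Real.log_two_gt_d9]

lemma simplestCubicRoot_isRoot {a : ℤ} (ha : 8 ≤ a) :
    simplestCubicRoot a ^ 3 - (a : ℝ) * simplestCubicRoot a ^ 2
      - ((a : ℝ) + 3) * simplestCubicRoot a - 1 = 0 := by
  have ha' : (8 : ℝ) ≤ a := by exact_mod_cast ha
  let s : Set ℝ := {x : ℝ | x ^ 3 - (a : ℝ) * x ^ 2 - ((a : ℝ) + 3) * x - 1 = 0}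
  have hne : s.Nonempty := by
    have hc : ContinuousOn (fun x : ℝ => x ^ 3 - (a : ℝ) * x ^ 2 - ((a : ℝ) + 3) * x - 1)
        (Set.Icc 0 ((a : ℝ) + 2)) := by fun_prop
    obtain ⟨x, -, hx⟩ := intermediate_value_Icc (by linarith) hc
      (show (0 : ℝ) ∈ Set.Icc _ _ from ⟨by norm_num, by nlinarith⟩)
    exact ⟨x, hx⟩
  have hclosed : IsClosed s := isClosed_eq (by fun_prop) continuous_const
  have hbdd : BddAbove s := by
    refine ⟨(a : ℝ) + 2, fun x hx => ?_⟩
    simp only [s, Set.mem_ofPred_eq] at hx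
    by_contra! h
    nlinarith [mul_pos (show (0 : ℝ) < x by linarith) (show (0 : ℝ) < x - a - 2 by linarith),
      mul_pos (mul_pos (show (0 : ℝ) < x by linarith) (show (0 : ℝ) < x by linarith))
        (show (0 : ℝ) < x - a - 2 by linarith)]
  exact hclosed.csSup_mem hne hbdd

open Polynomial in
/-- The simplest cubic polynomial over `ℚ`. -/
noncomputable def simplestCubic (a : ℤ) : ℚ[X] :=
  X ^ 3 - C (a : ℚ) * X ^ 2 - C ((a : ℚ) + 3) * X - 1

open Polynomial in
lemma simplestCubic_natDegree (a : ℤ) : (simplestCubic a).natDegree = 3 := by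
  unfold simplestCubic
  compute_degree!

open Polynomial in
lemma simplestCubic_monic (a : ℤ) : (simplestCubic a).Monic := by
  unfold simplestCubic
  monicity!

open Polynomial in
lemma simplestCubic_irreducible {a : ℤ} (ha : 8 ≤ a) : Irreducible (simplestCubic a) := by
  refine irreducible_of_degree_le_three_of_not_isRoot (by simp [simplestCubic_natDegree]) ?_
  intro q hq
  let p : ℤ[X] := X ^ 3 - C a * X ^ 2 - C (a + 3) * X - 1
  have hp : p.Monic := by
    simp only [p]
    monicity!
  simp only [simplestCubic, IsRoot.def, eval_sub, eval_pow, eval_X, eval_mul, eval_C,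
    eval_one] at hq
  obtain ⟨m, rfl⟩ := isInteger_of_is_root_of_monic hp (r := q) (by simpa [p, map_ofNat] using hq)
  simp only [algebraMap_int_eq, eq_intCast] at hq
  have h : m ^ 3 - a * m ^ 2 - (a + 3) * m - 1 = 0 := by exact_mod_cast hq
  have hu : m * (m ^ 2 - a * m - (a + 3)) = 1 := by linarith
  rcases Int.isUnit_iff.1 (IsUnit.of_mul_eq_one _ hu) with rfl | rfl <;> omega

/-- The norm form of the simplest cubic order in the basis `1, ρ, ρ²`. -/
lemma norm_sub_mul_add_mul_sq {a : ℤ} (ha : 8 ≤ a) {K : Type} [Field K] [NumberField K]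
    {ρ : K} (hρ : ρ ^ 3 - (a : K) * ρ ^ 2 - ((a : K) + 3) * ρ - 1 = 0)
    (hadj : IntermediateField.adjoin ℚ {ρ} = ⊤) (v w u : ℤ) :
    Algebra.norm ℚ ((v : K) - (w : K) * ρ + (u : K) * ρ ^ 2) =
      ((v ^ 3 - a * v ^ 2 * w + (a ^ 2 + 2 * a + 6) * v ^ 2 * u - (a + 3) * v * w ^ 2
        + (a ^ 2 + 3 * a + 3) * v * w * u + (a ^ 2 + 4 * a + 9) * v * u ^ 2 - w ^ 3
        + a * w ^ 2 * u + (a + 3) * w * u ^ 2 + u ^ 3 : ℤ) : ℚ) := by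
  have hint : IsIntegral ℚ ρ := Algebra.IsIntegral.isIntegral ρ
  have hadj' : Algebra.adjoin ℚ {ρ} = ⊤ := by
    rw [← IntermediateField.adjoin_simple_toSubalgebra_of_isAlgebraic hint.isAlgebraic, hadj]
    rfl
  have hmin : minpoly ℚ ρ = simplestCubic a := by
    refine (minpoly.eq_of_irreducible_of_monic (simplestCubic_irreducible ha) ?_
      (simplestCubic_monic a)).symm
    simpa [simplestCubic] using hρ
  let pb : PowerBasis ℚ K := PowerBasis.ofAdjoinEqTop' hint hadj'
  have hdim : pb.dim = 3 := by
    rw [PowerBasis.ofAdjoinEqTop'_dim, hmin, simplestCubic_natDegree]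
  have hgen : pb.gen = ρ := PowerBasis.ofAdjoinEqTop'_gen hint hadj'
  let b : Module.Basis (Fin 3) ℚ K := pb.basis.reindex (finCongr hdim)
  have hb : ∀ i, b i = ρ ^ (i : ℕ) := by
    intro i
    simp [b, hgen]
  have hM : Algebra.leftMulMatrix b ρ =
      !![0, 0, 1; 1, 0, (a : ℚ) + 3; 0, 1, (a : ℚ)] := by
    rw [Algebra.leftMulMatrix_apply, ← LinearEquiv.eq_symm_apply, LinearMap.toMatrix_symm]
    refine b.ext fun i => ?_
    rw [Matrix.toLin_self]
    fin_cases i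
    · simp [Fin.sum_univ_three, hb]
    · simp [Fin.sum_univ_three, hb, sq]
    · simp only [Fin.sum_univ_three, hb]
      simp [Algebra.smul_def]
      linear_combination hρ
  have hx : (v : K) - (w : K) * ρ + (u : K) * ρ ^ 2 =
      algebraMap ℚ K v - algebraMap ℚ K w * ρ + algebraMap ℚ K u * ρ ^ 2 := by simp
  have hdiag : ∀ m : ℚ, algebraMap ℚ (Matrix (Fin 3) (Fin 3) ℚ) m =
      !![m, 0, 0; 0, m, 0; 0, 0, m] := by
    intro m
    ext i j
    fin_cases i <;> fin_cases j <;> simp [Matrix.algebraMap_matrix_apply]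
  rw [hx, Algebra.norm_eq_matrix_det b]
  simp only [map_add, map_sub, map_mul, hM, AlgHom.commutes, hdiag, sq]
  rw [Matrix.det_fin_three]
  simp only [Matrix.add_apply, Matrix.sub_apply, Matrix.mul_apply, Fin.sum_univ_three]
  simp only [Matrix.of_apply, Matrix.cons_val', Matrix.cons_val_zero, Matrix.cons_val_one,
    Matrix.cons_val]
  push_cast
  ring

/-- The two floors are `(t - (a + 1) w) / D` and `(s + (a + 2) w) / D` with `1 ≤ s, t ≤ D`, where
`D = a² + 3a + 3`, and in these coordinates the norm form has only positive coefficients. -/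
lemma norm_floor_lower_bound {a : ℤ} (ha : 8 ≤ a) {w : ℤ} (hw : 1 ≤ w) {v u : ℤ}
    (hv : v = ⌊(-((a : ℝ) + 1) * w) / ((a : ℝ) ^ 2 + 3 * a + 3)⌋ + 1)
    (hu : u = ⌊(((a : ℝ) + 2) * w) / ((a : ℝ) ^ 2 + 3 * a + 3)⌋ + 1) :
    ∃ s t : ℤ, 1 ≤ s ∧ s ≤ a ^ 2 + 3 * a + 3 ∧ 1 ≤ t ∧ t ≤ a ^ 2 + 3 * a + 3 ∧
      (a ^ 2 + 3 * a + 3) * u = s + (a + 2) * w ∧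
      (a ^ 2 + 3 * a + 3) * v = t - (a + 1) * w ∧
      s * w * ((a ^ 2 + 3 * a + 3) * t + w) ≤ (a ^ 2 + 3 * a + 3) ^ 2 *
        (v ^ 3 - a * v ^ 2 * w + (a ^ 2 + 2 * a + 6) * v ^ 2 * u - (a + 3) * v * w ^ 2
          + (a ^ 2 + 3 * a + 3) * v * w * u + (a ^ 2 + 4 * a + 9) * v * u ^ 2 - w ^ 3
          + a * w ^ 2 * u + (a + 3) * w * u ^ 2 + u ^ 3) := by
  obtain ⟨D, hD⟩ : ∃ D : ℤ, D = a ^ 2 + 3 * a + 3 := ⟨_, rfl⟩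
  have hDr : (a : ℝ) ^ 2 + 3 * a + 3 = D := by rw [hD]; push_cast; ring
  have hD0 : 0 < D := by nlinarith
  have hD0' : (0 : ℝ) < D := by exact_mod_cast hD0
  have floor_bounds : ∀ m y : ℤ, y = ⌊(m : ℝ) / D⌋ + 1 → 1 ≤ D * y - m ∧ D * y - m ≤ D := by
    intro m y hy
    have h1 := Int.floor_le ((m : ℝ) / D)
    have h2 := Int.lt_floor_add_one ((m : ℝ) / D)
    rw [le_div_iff₀ hD0'] at h1
    rw [div_lt_iff₀ hD0'] at h2
    have h1' : ⌊(m : ℝ) / D⌋ * D ≤ m := by exact_mod_cast h1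
    have h2' : m < (⌊(m : ℝ) / D⌋ + 1) * D := by exact_mod_cast h2
    subst hy
    constructor <;> nlinarith
  obtain ⟨hs1, hs2⟩ := floor_bounds ((a + 2) * w) u (by rw [hu, hDr]; push_cast; rfl)
  obtain ⟨ht1, ht2⟩ := floor_bounds (-(a + 1) * w) v (by rw [hv, hDr]; push_cast; rfl)
  obtain ⟨s, hs⟩ : ∃ s, s = D * u - (a + 2) * w := ⟨_, rfl⟩
  obtain ⟨t, ht⟩ : ∃ t, t = D * v - -(a + 1) * w := ⟨_, rfl⟩
  rw [← hs] at hs1 hs2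
  rw [← ht] at ht1 ht2
  rw [← hD]
  refine ⟨s, t, hs1, hs2, ht1, ht2, by linarith, by linarith, ?_⟩
  refine le_of_mul_le_mul_left ?_ hD0
  have hform : D * (D ^ 2 * (v ^ 3 - a * v ^ 2 * w + (a ^ 2 + 2 * a + 6) * v ^ 2 * u
      - (a + 3) * v * w ^ 2 + D * v * w * u + (a ^ 2 + 4 * a + 9) * v * u ^ 2
      - w ^ 3 + a * w ^ 2 * u + (a + 3) * w * u ^ 2 + u ^ 3)) =
      t ^ 3 + s ^ 3 + w ^ 3 + (a ^ 2 + 2 * a + 6) * (t ^ 2 * s + s ^ 2 * w + w ^ 2 * t)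
      + (a ^ 2 + 4 * a + 9) * (t ^ 2 * w + s ^ 2 * t + w ^ 2 * s)
      + (D ^ 2 + 6 * a ^ 2 + 18 * a + 24) * (t * s * w) := by
    rw [hs, ht, hD]
    ring
  rw [hform]
  have hsp : 0 < s := by linarith
  have htp : 0 < t := by linarith
  have hwp : 0 < w := by linarith
  have hap : 0 < a := by linarith
  have hdiff : t ^ 3 + s ^ 3 + w ^ 3 + (a ^ 2 + 2 * a + 6) * (t ^ 2 * s + s ^ 2 * w + w ^ 2 * t)
      + (a ^ 2 + 4 * a + 9) * (t ^ 2 * w + s ^ 2 * t + w ^ 2 * s)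
      + (D ^ 2 + 6 * a ^ 2 + 18 * a + 24) * (t * s * w) - D * (s * w * (D * t + w)) =
      t ^ 3 + s ^ 3 + w ^ 3 + (a ^ 2 + 2 * a + 6) * (t ^ 2 * s + s ^ 2 * w + w ^ 2 * t)
      + (a ^ 2 + 4 * a + 9) * (t ^ 2 * w + s ^ 2 * t) + (a + 6) * (w ^ 2 * s)
      + (6 * a ^ 2 + 18 * a + 24) * (t * s * w) := by
    rw [hD]
    ring
  rw [← sub_nonneg, hdiff]
  positivity

lemma eq_of_mul_eq_sub {D m s s' : ℤ} (hs : 1 ≤ s) (hsD : s ≤ D) (hs' : 1 ≤ s') (hsD' : s' ≤ D)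
    (h : D * m = s - s') : s = s' := by
  have hD : 0 < D := by linarith
  have h1 : m < 1 := by
    by_contra! hm
    nlinarith
  have h2 : -1 < m := by
    by_contra! hm
    nlinarith
  have h3 : m = 0 := by omega
  rw [h3] at h
  linarith

/-- The triples `(s, t, w)` modulo `D = a² + 3a + 3` consist of two triangles and the origin. -/
lemma exists_triangle_coordinates {a : ℤ} (ha : 8 ≤ a) {w s t u v D : ℤ}
    (hD : D = a ^ 2 + 3 * a + 3) (hw : 1 ≤ w)
    (hs : 1 ≤ s) (hsD : s ≤ D) (ht : 1 ≤ t) (htD : t ≤ D)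
    (hu : D * u = s + (a + 2) * w) (hv : D * v = t - (a + 1) * w) :
    ∃ k : ℤ, 0 ≤ k ∧ ((1 ≤ k ∧ s = D ∧ t = D ∧ w = k * D) ∨
      ∃ x y z : ℤ, 0 ≤ x ∧ 0 ≤ y ∧ 0 ≤ z ∧ x + y + z = a ∧
        ((w = 1 + z + (a + 2) * y + k * D ∧ s = 1 + y + (a + 2) * x ∧ t = 1 + x + (a + 2) * z) ∨
          (w = D - (1 + z + (a + 2) * y) + k * D ∧ s = D - (1 + y + (a + 2) * x) ∧
            t = D - (1 + x + (a + 2) * z)))) := by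
  have hD0 : 0 < D := by rw [hD]; positivity
  have bound : ∀ x y : ℤ, 0 ≤ x → 0 ≤ y → x + y ≤ a → 1 ≤ 1 + y + (a + 2) * x ∧
      1 + y + (a + 2) * x ≤ D - 1 := by
    intro x y hx hy hxy
    rw [hD]
    constructor <;> nlinarith
  have hwk : w = w % D + w / D * D := by linarith [Int.emod_add_mul_ediv w D]
  have hm0 := Int.emod_nonneg w hD0.ne'
  have hm1 := Int.emod_lt_of_pos w hD0
  have hk : 0 ≤ w / D := Int.ediv_nonneg (by linarith) hD0.le
  generalize w / D = k at *
  generalize w % D = m at *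
  refine ⟨k, hk, ?_⟩
  rcases hm0.eq_or_lt with rfl | hm
  · left
    have hk1 : 1 ≤ k := by
      by_contra! h
      have : k = 0 := by omega
      rw [this] at hwk
      linarith
    refine ⟨hk1, ?_, ?_, by linarith⟩
    · exact eq_of_mul_eq_sub hs hsD (by linarith) le_rfl (m := u - (a + 2) * k - 1)
        (by linear_combination hu + (a + 2) * hwk)
    · exact eq_of_mul_eq_sub ht htD (by linarith) le_rfl (m := v + (a + 1) * k - 1)
        (by linear_combination hv - (a + 1) * hwk)
  · right
    have hdiv := Int.emod_add_mul_ediv (m - 1) (a + 2)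
    have hz0 := Int.emod_nonneg (m - 1) (show a + 2 ≠ 0 by linarith)
    have hz1 := Int.emod_lt_of_pos (m - 1) (show 0 < a + 2 by linarith)
    have hy0 : 0 ≤ (m - 1) / (a + 2) := Int.ediv_nonneg (by linarith) (by linarith)
    generalize (m - 1) / (a + 2) = y at *
    generalize (m - 1) % (a + 2) = z at *
    have hy1 : y ≤ a := by
      by_contra! h
      nlinarith
    rcases le_or_gt (y + z) a with hyz | hyz
    · refine ⟨a - y - z, y, z, by linarith, hy0, hz0, by ring, Or.inl ⟨by linarith, ?_, ?_⟩⟩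
      · obtain ⟨h1, h2⟩ := bound (a - y - z) y (by linarith) hy0 (by linarith)
        refine eq_of_mul_eq_sub hs hsD h1 (by linarith) (m := u - (a + 2) * k - (1 + y)) ?_
        linear_combination hu + (a + 2) * hwk - (a + 2) * hdiv - (1 + y) * hD
      · obtain ⟨h1, h2⟩ := bound z (a - y - z) hz0 (by linarith) (by linarith)
        refine eq_of_mul_eq_sub ht htD h1 (by linarith) (m := v + (a + 1) * k + y) ?_
        linear_combination hv - (a + 1) * hwk + (a + 1) * hdiv + y * hD
    · refine ⟨y + z - a - 1, a - y, a + 1 - z, by linarith, by linarith, by linarith, by ring,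
        Or.inr ⟨?_, ?_, ?_⟩⟩
      · linear_combination hwk - hdiv - hD
      · obtain ⟨h1, h2⟩ := bound (y + z - a - 1) (a - y) (by linarith) (by linarith) (by linarith)
        refine eq_of_mul_eq_sub hs hsD (by linarith) (by linarith)
          (m := u - (a + 2) * k - (2 + y)) ?_
        linear_combination hu + (a + 2) * hwk - (a + 2) * hdiv - (1 + y) * hD
      · obtain ⟨h1, h2⟩ := bound (a + 1 - z) (y + z - a - 1) (by linarith) (by linarith)
          (by linarith)
        refine eq_of_mul_eq_sub ht htD (by linarith) (by linarith)
          (m := v + (a + 1) * k + y) ?_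
        linear_combination hv - (a + 1) * hwk + (a + 1) * hdiv + (y + 1) * hD

lemma edge_or_interior_of_mul_le {a x y z N : ℤ} (ha : 8 ≤ a) (hx : 0 ≤ x) (hz : 0 ≤ z)
    (hsum : x + y + z = a) (hy : a ≤ 3 * y)
    (h : (1 + z + (a + 2) * y) * (1 + y + (a + 2) * x) * (1 + x + (a + 2) * z) ≤
      2 * a ^ 2 * N) :
    (z = 0 ∧ (1 + x) * 1 * (1 + x + 1) * a ≤ 36 * N) ∨
      (1 ≤ z ∧ (1 + x) * z * 1 * a ^ 2 ≤ 18 * N) := by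
  have h1 : a ^ 2 ≤ 3 * (1 + z + (a + 2) * y) := by nlinarith
  have h2 : a * (1 + x) ≤ 3 * (1 + y + (a + 2) * x) := by
    nlinarith [mul_nonneg (by linarith : 0 ≤ a) hx]
  have ht : 0 ≤ 1 + x + (a + 2) * z := by positivity
  have h3 : a ^ 2 * (a * (1 + x)) ≤
      (3 * (1 + z + (a + 2) * y)) * (3 * (1 + y + (a + 2) * x)) :=
    mul_le_mul h1 h2 (by positivity) (by nlinarith)
  have h4 := mul_le_mul_of_nonneg_right h3 ht
  have h5 : a * (1 + x) * (1 + x + (a + 2) * z) ≤ 18 * N := by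
    refine le_of_mul_le_mul_left ?_ (show 0 < a ^ 2 by positivity)
    linarith
  rcases hz.eq_or_lt with rfl | hz
  · left
    refine ⟨rfl, ?_⟩
    nlinarith [mul_nonneg (show 0 ≤ a by linarith) (mul_nonneg hx (show 0 ≤ 1 + x by linarith))]
  · right
    refine ⟨hz, le_trans ?_ h5⟩
    nlinarith [mul_nonneg (mul_nonneg (show 0 ≤ a by linarith) (show 0 ≤ 1 + x by linarith))
      (show 0 ≤ 1 + x + 2 * z by linarith)]

lemma mul_le_of_two_mul_le {a p q r P Q R N : ℤ} (ha : 8 ≤ a) (hp : 1 ≤ p) (hq : 1 ≤ q)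
    (hr : 2 * a ≤ 3 * r) (hP : a * p ≤ P) (hQ : a * q ≤ Q) (hR : a * r ≤ R)
    (h : P * Q * R ≤ 2 * a ^ 2 * N) : p * q * 1 * a ^ 2 ≤ 18 * N := by
  have ha0 : 0 < a := by linarith
  have h1 : a * p * (a * q) ≤ P * Q :=
    mul_le_mul hP hQ (by positivity) (le_trans (by positivity) hP)
  have h2 : a * p * (a * q) * (2 * a ^ 2) ≤ P * Q * (3 * R) :=
    mul_le_mul h1 (by nlinarith) (by positivity) (le_trans (by positivity) h1)
  have h3 : p * q * a ^ 2 ≤ 3 * N := by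
    refine le_of_mul_le_mul_left ?_ (show 0 < 2 * a ^ 2 by positivity)
    linarith
  have h4 : 0 < p * q * a ^ 2 := by positivity
  linarith

/-- The integers `w` recovered from a triple of `boundedTriples`. -/
def tripleMap (a : ℤ) : Fin 11 → ℤ → ℤ → ℤ → ℤ := ![
  fun p q k => 1 + q + (a + 2) * (a - p - q) + k * (a ^ 2 + 3 * a + 3),
  fun p _ k => 1 + (a + 1 - p) + (a + 2) * (p - 1) + k * (a ^ 2 + 3 * a + 3),
  fun _ q k => 1 + q + (a + 2) * (a - q) + k * (a ^ 2 + 3 * a + 3),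
  fun p q _ => 1 + q + (a + 2) * (a + 1 - p - q),
  fun p q _ => 1 + (p - 1) + (a + 2) * q,
  fun p q _ => 1 + (a + 1 - p - q) + (a + 2) * (p - 1),
  fun p q k => a ^ 2 + 3 * a + 3 - (1 + (a + 1 - q) + (a + 2) * (p + q - a - 2))
    + k * (a ^ 2 + 3 * a + 3),
  fun p q _ => a ^ 2 + 3 * a + 3 - (1 + (a + 1 - q) + (a + 2) * (p + q - a - 2)),
  fun p q _ => a ^ 2 + 3 * a + 3 - (1 + (p + q - a - 2) + (a + 2) * (a + 1 - q)),
  fun p q _ => a ^ 2 + 3 * a + 3 - (1 + (a + 1 - p) + (a + 2) * (a + 1 - q)),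
  fun _ _ k => k * (a ^ 2 + 3 * a + 3)]

/-- The integers `w` recovered from a pair of `cubicPairs`. -/
def pairMap (a : ℤ) : Fin 4 → ℤ → ℤ → ℤ := ![
  fun p k => 1 + (a + 2) * (a + 1 - p) + k * (a ^ 2 + 3 * a + 3),
  fun p _ => 1 + (a + 2) * (a + 1 - p),
  fun p _ => 1 + (p - 1),
  fun p _ => 1 + (a + 1 - p) + (a + 2) * (p - 1)]

/-- `w` comes from a triple or a pair whose product is small compared with `N`. -/
def IsCovered (a N w : ℤ) : Prop :=
  (∃ i p q k, 1 ≤ p ∧ p ≤ a + 1 ∧ 1 ≤ q ∧ q ≤ a + 1 ∧ 1 ≤ k ∧ p * q * k * a ^ 2 ≤ 18 * N ∧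
    w = tripleMap a i p q k) ∨
  ∃ i p k, 1 ≤ p ∧ 1 ≤ k ∧ p * k * (p + k) * a ≤ 36 * N ∧ w = pairMap a i p k

lemma isCovered_lower_of_pos {a x y z k N D : ℤ} (ha : 8 ≤ a) (hD : D = a ^ 2 + 3 * a + 3)
    (hx : 0 ≤ x) (hy : 0 ≤ y) (hz : 0 ≤ z) (hsum : x + y + z = a) (hk : 1 ≤ k)
    (h : k * (1 + y + (a + 2) * x) * (1 + x + (a + 2) * z + k) ≤ N) :
    IsCovered a N (1 + z + (a + 2) * y + k * D) := by
  have ha0 : 0 < a := by linarith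
  have hN : 0 ≤ N := le_trans (by positivity) h
  rcases hz.eq_or_lt with rfl | hz1
  · obtain rfl : y = a - x := by linarith
    refine Or.inr ⟨0, 1 + x, k, by linarith, hk, ?_, ?_⟩
    · have h1 : (1 + x) * a ≤ 1 + (a - x) + (a + 2) * x := by nlinarith
      have h2 : k * ((1 + x) * a) * (1 + x + (a + 2) * 0 + k) ≤
          k * (1 + (a - x) + (a + 2) * x) * (1 + x + (a + 2) * 0 + k) := by gcongr
      nlinarith
    · simp only [pairMap, Matrix.cons_val, hD]; ring
  rcases hx.eq_or_lt with rfl | hx1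
  · obtain rfl : z = a - y := by linarith
    have h0 : k * (1 + y) * (a * (a - y)) ≤ N := by
      refine le_trans ?_ h
      have : a * (a - y) ≤ 1 + 0 + (a + 2) * (a - y) + k := by linarith
      have h3 : 0 ≤ k * (1 + y) := by positivity
      nlinarith [mul_le_mul_of_nonneg_left this h3]
    rcases le_or_gt (1 + y) (a - y) with hyz | hyz
    · refine Or.inl ⟨1, 1 + y, 1, k, by linarith, by linarith, le_rfl, by linarith, hk, ?_, ?_⟩
      · have h3 : 0 ≤ k * (1 + y) * a := by positivity
        nlinarith [mul_le_mul_of_nonneg_left (show a ≤ 2 * (a - y) by linarith) h3]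
      · simp only [tripleMap, Matrix.cons_val, hD]; ring
    · refine Or.inl ⟨2, 1, a - y, k, le_rfl, by linarith, by linarith, by linarith, hk, ?_, ?_⟩
      · have h3 : 0 ≤ k * (a - y) * a := by positivity
        nlinarith [mul_le_mul_of_nonneg_left (show a ≤ 2 * (1 + y) by linarith) h3]
      · simp [tripleMap, hD]
  · refine Or.inl ⟨0, x, z, k, hx1, by linarith, hz1, by linarith, hk, ?_, ?_⟩
    · have h1 : k * (a * x) * (a * z) ≤
          k * (1 + y + (a + 2) * x) * (1 + x + (a + 2) * z + k) := by
        gcongr <;> nlinarith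
      nlinarith
    · obtain rfl : y = a - x - z := by linarith
      simp [tripleMap, hD]

lemma isCovered_lower {a x y z N : ℤ} (ha : 8 ≤ a)
    (hx : 0 ≤ x) (hy : 0 ≤ y) (hz : 0 ≤ z) (hsum : x + y + z = a)
    (h : (1 + z + (a + 2) * y) * (1 + y + (a + 2) * x) * (1 + x + (a + 2) * z) ≤
      2 * a ^ 2 * N) :
    IsCovered a N (1 + z + (a + 2) * y) := by
  have hbig : a ≤ 3 * y ∨ a ≤ 3 * x ∨ a ≤ 3 * z := by omega
  rcases hbig with hb | hb | hb
  · rcases edge_or_interior_of_mul_le ha hx hz hsum hb h with ⟨rfl, h'⟩ | ⟨hz1, h'⟩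
    · obtain rfl : y = a - x := by linarith
      exact Or.inr ⟨1, 1 + x, 1, by linarith, le_rfl, h', by simp only [pairMap, Matrix.cons_val]; ring⟩
    · obtain rfl : y = a - x - z := by linarith
      exact Or.inl ⟨3, 1 + x, z, 1, by linarith, by linarith, hz1, by linarith, le_rfl, h',
        by simp only [tripleMap, Matrix.cons_val]; ring⟩
  · rcases edge_or_interior_of_mul_le ha hz hy (by linarith) hb (by linarith) with
      ⟨rfl, h'⟩ | ⟨hy1, h'⟩
    · exact Or.inr ⟨2, 1 + z, 1, by linarith, le_rfl, h', by simp [pairMap]⟩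
    · exact Or.inl ⟨4, 1 + z, y, 1, by linarith, by linarith, hy1, by linarith, le_rfl, h',
        by simp [tripleMap]⟩
  · rcases edge_or_interior_of_mul_le ha hy hx (by linarith) hb (by linarith) with
      ⟨rfl, h'⟩ | ⟨hx1, h'⟩
    · obtain rfl : z = a - y := by linarith
      exact Or.inr ⟨3, 1 + y, 1, by linarith, le_rfl, h', by simp only [pairMap, Matrix.cons_val]; ring⟩
    · obtain rfl : z = a - x - y := by linarith
      exact Or.inl ⟨5, 1 + y, x, 1, by linarith, by linarith, hx1, by linarith, le_rfl, h',
        by simp only [tripleMap, Matrix.cons_val]; ring⟩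

/-- In the upper triangle the coordinates `p, q, r` satisfy `p + q + r = 2a + 3`. -/
lemma isCovered_upper {a p q r k N s t w D : ℤ} (ha : 8 ≤ a) (hD : D = a ^ 2 + 3 * a + 3)
    (hp : 1 ≤ p) (hp' : p ≤ a + 1) (hq : 1 ≤ q) (hq' : q ≤ a + 1) (hr : 1 ≤ r) (hr' : r ≤ a + 1)
    (hsum : p + q + r = 2 * a + 3) (hk : 0 ≤ k)
    (hs : a * p ≤ s) (ht : a * q ≤ t) (hwr : a * r ≤ w)
    (hw : w = D - (1 + (a + 1 - q) + (a + 2) * (a + 1 - r)) + k * D)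
    (hpos : 1 ≤ k → k * s * (t + k) ≤ N) (hprod : s * t * w ≤ 2 * a ^ 2 * N) :
    IsCovered a N w := by
  have ha0 : 0 < a := by linarith
  rcases hk.eq_or_lt with rfl | hk1
  · have hbig : 2 * a ≤ 3 * r ∨ 2 * a ≤ 3 * q ∨ 2 * a ≤ 3 * p := by omega
    rcases hbig with hb | hb | hb
    · refine Or.inl ⟨7, p, q, 1, hp, hp', hq, hq', le_rfl,
        mul_le_of_two_mul_le ha hp hq hb hs ht hwr hprod, ?_⟩
      obtain rfl : r = 2 * a + 3 - p - q := by linarith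
      simp only [tripleMap, Matrix.cons_val, hw, hD]; ring
    · refine Or.inl ⟨8, p, r, 1, hp, hp', hr, hr', le_rfl,
        mul_le_of_two_mul_le ha hp hr hb hs hwr ht (by linarith), ?_⟩
      obtain rfl : q = 2 * a + 3 - p - r := by linarith
      simp only [tripleMap, Matrix.cons_val, hw, hD]; ring
    · refine Or.inl ⟨9, q, r, 1, hq, hq', hr, hr', le_rfl,
        mul_le_of_two_mul_le ha hq hr hb ht hwr hs (by linarith), ?_⟩
      simp [tripleMap, hw, hD]
  · refine Or.inl ⟨6, p, q, k, hp, hp', hq, hq', hk1, ?_, ?_⟩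
    · have h1 : k * (a * p) * (a * q) ≤ k * s * (t + k) := by
        have : 0 ≤ s := le_trans (by positivity) hs
        gcongr
        linarith
      have h2 : 0 < k * (a * p) * (a * q) := by positivity
      linarith [hpos hk1]
    · obtain rfl : r = 2 * a + 3 - p - q := by linarith
      simp only [tripleMap, Matrix.cons_val, hw, hD]; ring

lemma isCovered_of_mul_le {a : ℤ} (ha : 8 ≤ a) {w s t u v D N : ℤ}
    (hD : D = a ^ 2 + 3 * a + 3) (hw : 1 ≤ w)
    (hs : 1 ≤ s) (hsD : s ≤ D) (ht : 1 ≤ t) (htD : t ≤ D)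
    (hu : D * u = s + (a + 2) * w) (hv : D * v = t - (a + 1) * w)
    (hN : s * w * (D * t + w) ≤ D ^ 2 * N) : IsCovered a N w := by
  have hD0 : 0 < D := by linarith
  have hD2 : D ≤ 2 * a ^ 2 := by nlinarith
  have ha0 : 0 < a := by linarith
  have hprod : s * t * w ≤ D * N := by
    refine le_of_mul_le_mul_left (le_trans ?_ (hN.trans_eq (by ring : _ = D * (D * N)))) hD0
    nlinarith [show 0 ≤ s * w * w by positivity]
  have hN0 : 0 ≤ N := by
    by_contra! h
    nlinarith [show 0 < s * t * w by positivity]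
  have hprod' : s * t * w ≤ 2 * a ^ 2 * N := hprod.trans (by gcongr)
  have hpos : ∀ k, 1 ≤ k → k * D ≤ w → k * s * (t + k) ≤ N := by
    intro k hk hkw
    refine le_of_mul_le_mul_left (le_trans ?_ hN) (show 0 < D ^ 2 by positivity)
    calc D ^ 2 * (k * s * (t + k)) = s * (k * D) * (D * t + k * D) := by ring
      _ ≤ _ := by gcongr
  obtain ⟨k, hk, ⟨hk1, rfl, rfl, rfl⟩ | ⟨x, y, z, hx, hy, hz, hsum, ⟨hw', hs', ht'⟩ |
    ⟨hw', hs', ht'⟩⟩⟩ := exists_triangle_coordinates ha hD hw hs hsD ht htD hu hv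
  · refine Or.inl ⟨10, 1, 1, k, le_rfl, by linarith, le_rfl, by linarith, hk1, ?_, ?_⟩
    · have h1 := hpos k hk1 le_rfl
      have h2 : a ^ 2 ≤ t := by nlinarith
      have h3 : k * a ^ 2 * 1 ≤ k * t * (t + k) := by gcongr; linarith
      linarith
    · simp [tripleMap, hD]
  · rcases hk.eq_or_lt with rfl | hk1
    · rw [hw', zero_mul, add_zero]
      refine isCovered_lower ha hx hy hz hsum (le_trans (le_of_eq ?_) hprod')
      rw [hw', hs', ht']
      ring
    · have h1 := hpos k hk1 (by rw [hw']; nlinarith)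
      rw [hs', ht'] at h1
      rw [hw']
      exact isCovered_lower_of_pos ha hD hx hy hz hsum hk1 h1
  · have hkw : a * (x + z + 1) + k * D ≤ w := by
      rw [hw', hD]
      nlinarith
    refine isCovered_upper ha hD (p := y + z + 1) (q := x + y + 1) (r := x + z + 1) (k := k)
      (by linarith) (by linarith) (by linarith) (by linarith) (by linarith) (by linarith)
      (by linarith) hk ?_ ?_ ?_ ?_ (fun hk1 => hpos k hk1 ?_) hprod'
    · rw [hs', hD]; nlinarith
    · rw [ht', hD]; nlinarith
    · nlinarith
    · rw [hw', ← hsum]; ring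
    · nlinarith

lemma ncard_isCovered_le {a : ℤ} (ha : 8 ≤ a) {x : ℝ} (hx : 0 ≤ x) {W : Set ℤ}
    (hW : ∀ w ∈ W, ∃ N : ℤ, (N : ℝ) ≤ x ∧ IsCovered a N w) :
    (W.ncard : ℝ) ≤ 1000 * ((Real.log a) ^ 2 * x / (a : ℝ) ^ 2 + (x / a) ^ ((2 : ℝ) / 3)) := by
  obtain ⟨n, rfl⟩ : ∃ n : ℕ, a = n := ⟨a.toNat, by omega⟩
  have hn : 8 ≤ n := by omega
  have hn0 : (0 : ℝ) < n := by exact_mod_cast (by omega : 0 < n)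
  obtain ⟨hTfin, hT⟩ := boundedTriples_finite_ncard_le (n + 1) (Z := 18 * x / (n : ℝ) ^ 2)
    (by positivity)
  obtain ⟨hPfin, hP⟩ := cubicPairs_finite_ncard_le (Z := 36 * (x / n)) (by positivity)
  set T := boundedTriples (n + 1) (18 * x / (n : ℝ) ^ 2)
  set P := cubicPairs (36 * (x / n))
  let A : Fin 11 → Set ℤ := fun i => (fun t : ℕ × ℕ × ℕ => tripleMap n i t.1 t.2.1 t.2.2) '' T
  let B : Fin 4 → Set ℤ := fun i => (fun t : ℕ × ℕ => pairMap n i t.1 t.2) '' P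
  have hsub : W ⊆ (⋃ i, A i) ∪ ⋃ i, B i := by
    intro w hw
    obtain ⟨N, hN, ⟨i, p, q, k, hp, hp', hq, hq', hk, h, rfl⟩ | ⟨i, p, k, hp, hk, h, rfl⟩⟩ :=
      hW w hw
    · lift p to ℕ using by linarith
      lift q to ℕ using by linarith
      lift k to ℕ using by linarith
      refine Or.inl (Set.mem_iUnion.2 ⟨i, (p, q, k), ⟨?_, ?_, ?_, ?_⟩, rfl⟩)
      · exact Finset.mem_Icc.2 (by simp only; omega)
      · exact Finset.mem_Icc.2 (by simp only; omega)
      · simp only; omega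
      · rw [le_div_iff₀ (by positivity)]
        have h' : (p * q * k * n ^ 2 : ℝ) ≤ 18 * N := by exact_mod_cast h
        linarith
    · lift p to ℕ using by linarith
      lift k to ℕ using by linarith
      refine Or.inr (Set.mem_iUnion.2 ⟨i, (p, k), ⟨?_, ?_, ?_⟩, rfl⟩)
      · simp only; omega
      · simp only; omega
      · rw [← mul_div_assoc, le_div_iff₀ hn0]
        have h' : (p * k * (p + k) * n : ℝ) ≤ 36 * N := by exact_mod_cast h
        linarith
  have hA : (⋃ i, A i).ncard ≤ 11 * T.ncard := by
    refine (Set.ncard_iUnion_le_of_fintype A).trans ?_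
    refine (Finset.sum_le_card_nsmul _ _ T.ncard fun i _ => Set.ncard_image_le hTfin).trans ?_
    simp
  have hB : (⋃ i, B i).ncard ≤ 4 * P.ncard := by
    refine (Set.ncard_iUnion_le_of_fintype B).trans ?_
    refine (Finset.sum_le_card_nsmul _ _ P.ncard fun i _ => Set.ncard_image_le hPfin).trans ?_
    simp
  have hW : W.ncard ≤ 11 * T.ncard + 4 * P.ncard :=
    (Set.ncard_le_ncard hsub ((Set.finite_iUnion fun i => hTfin.image _).union
      (Set.finite_iUnion fun i => hPfin.image _))).trans
      ((Set.ncard_union_le _ _).trans (add_le_add hA hB))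
  have hWr : (W.ncard : ℝ) ≤ 11 * T.ncard + 4 * P.ncard := by exact_mod_cast hW
  have hT' : (T.ncard : ℝ) ≤ 72 * ((Real.log n) ^ 2 * x / (n : ℝ) ^ 2) := by
    calc (T.ncard : ℝ) ≤ _ := hT
      _ ≤ 18 * x / (n : ℝ) ^ 2 * (2 * Real.log n) ^ 2 := by
        gcongr
        exact sum_inv_le_two_mul_log hn
      _ = _ := by ring
  have hP' : (P.ncard : ℝ) ≤ 144 * (x / n) ^ ((2 : ℝ) / 3) := by
    have h36 : (36 : ℝ) ^ ((2 : ℝ) / 3) ≤ 36 := by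
      simpa using Real.rpow_le_rpow_of_exponent_le (show (1 : ℝ) ≤ 36 by norm_num)
        (show (2 : ℝ) / 3 ≤ 1 by norm_num)
    rw [Real.mul_rpow (by norm_num) (by positivity)] at hP
    nlinarith [show (0 : ℝ) ≤ (x / n) ^ ((2 : ℝ) / 3) by positivity]
  have h1 : (0 : ℝ) ≤ (Real.log n) ^ 2 * x / (n : ℝ) ^ 2 := by positivity
  have h2 : (0 : ℝ) ≤ (x / n) ^ ((2 : ℝ) / 3) := by positivity
  push_cast
  linarith

theorem stmt_17 :
    ∃ C : ℝ, 0 < C ∧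
      ∀ (a : ℤ), 8 ≤ a →
      ∀ (K : Type) [Field K] [NumberField K] (σ : K →+* ℝ) (ρK : K),
        σ ρK = simplestCubicRoot a →
        IntermediateField.adjoin ℚ {ρK} = ⊤ →
        ∀ x : ℝ, 1 ≤ x →
          (Set.ncard {w : ℤ | 1 ≤ w ∧
              ((Algebra.norm ℚ
                (((⌊(-((a : ℝ) + 1) * w) / ((a : ℝ) ^ 2 + 3 * a + 3)⌋ + 1 : ℤ) : K)
                  - (w : K) * ρK +
                  ((⌊(((a : ℝ) + 2) * w) / ((a : ℝ) ^ 2 + 3 * a + 3)⌋ + 1 : ℤ) : K)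
                    * ρK ^ 2) : ℚ) : ℝ) ≤ x} : ℝ) ≤
            C * ((Real.log a) ^ 2 * x / (a : ℝ) ^ 2 + (x / a) ^ ((2 : ℝ) / 3)) := by
  refine ⟨1000, by norm_num, fun a ha K _ _ σ ρ hσ hadj x hx => ?_⟩
  have hρ : ρ ^ 3 - (a : K) * ρ ^ 2 - ((a : K) + 3) * ρ - 1 = 0 := by
    apply σ.injective
    simpa [hσ, map_ofNat] using simplestCubicRoot_isRoot ha
  refine ncard_isCovered_le ha (by linarith) fun w hw => ?_
  obtain ⟨hw1, hN⟩ := hw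
  obtain ⟨s, t, hs, hsD, ht, htD, hu, hv, hle⟩ := norm_floor_lower_bound ha hw1 rfl rfl
  rw [norm_sub_mul_add_mul_sq ha hρ hadj] at hN
  exact ⟨_, by exact_mod_cast hN, isCovered_of_mul_le ha rfl hw1 hs hsD ht htD hu hv hle⟩
end

section
/- There exist constants c > 0 and c' > 0 such that for every integer a ≥ 8 for which the ring of integers of the simplest cubic field K_a equals ℤ[ρ], and for every real number x ≥ c·a³, one has P_p(a, x) ≥ c'·(log a)²·x/a². -/
open NumberField

section Root

lemma simplestCubic_pos_of_ge {a x : ℝ} (ha : 8 ≤ a) (hx : a + 2 ≤ x) :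
    0 < x ^ 3 - a * x ^ 2 - (a + 3) * x - 1 := by
  nlinarith [mul_nonneg (sub_nonneg.2 hx) (sq_nonneg x),
    mul_nonneg (sub_nonneg.2 hx) (by linarith : (0 : ℝ) ≤ x)]

lemma simplestCubicRoot_spec {a : ℤ} (ha : 8 ≤ a) :
    simplestCubicRoot a ^ 3 - (a : ℝ) * simplestCubicRoot a ^ 2
        - ((a : ℝ) + 3) * simplestCubicRoot a - 1 = 0 ∧
      (a : ℝ) + 1 < simplestCubicRoot a ∧ simplestCubicRoot a < a + 2 := by
  have ha' : (8 : ℝ) ≤ a := by exact_mod_cast ha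
  set f : ℝ → ℝ := fun x => x ^ 3 - (a : ℝ) * x ^ 2 - ((a : ℝ) + 3) * x - 1 with hf
  have hcont : Continuous f := by fun_prop
  have hub : ∀ x, f x = 0 → x < a + 2 := by
    intro x hx
    by_contra! h
    exact (simplestCubic_pos_of_ge ha' h).ne' hx
  have h1 : f (a + 1) < 0 := by simp only [hf]; nlinarith
  have h2 : 0 < f (a + 2) := simplestCubic_pos_of_ge ha' le_rfl
  obtain ⟨y, hy, hy0⟩ := intermediate_value_Icc (by linarith : (a : ℝ) + 1 ≤ a + 2)
    hcont.continuousOn ⟨h1.le, h2.le⟩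
  have hbdd : BddAbove {x | f x = 0} := ⟨a + 2, fun x hx => (hub x hx).le⟩
  have hmem : simplestCubicRoot a ∈ {x | f x = 0} :=
    (isClosed_eq hcont continuous_const).csSup_mem ⟨y, hy0⟩ hbdd
  have hle : y ≤ simplestCubicRoot a := le_csSup hbdd hy0
  refine ⟨hmem, lt_of_lt_of_le (lt_of_le_of_ne hy.1 ?_) hle, hub _ hmem⟩
  rintro rfl
  exact h1.ne hy0

end Root

section Algebraic

open Polynomial

/-- The simplest cubic polynomial `X³ - aX² - (a+3)X - 1`. -/
noncomputable def simplestCubicPoly (a : ℤ) : ℤ[X] :=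
  X ^ 3 - C a * X ^ 2 - C (a + 3) * X - 1

lemma simplestCubicPoly_monic (a : ℤ) : (simplestCubicPoly a).Monic := by
  unfold simplestCubicPoly; monicity!

lemma simplestCubicPoly_natDegree (a : ℤ) : (simplestCubicPoly a).natDegree = 3 := by
  unfold simplestCubicPoly; compute_degree!

lemma simplestCubicPoly_irreducible (a : ℤ) : Irreducible (simplestCubicPoly a) := by
  rw [(simplestCubicPoly_monic a).irreducible_iff_roots_eq_zero_of_degree_le_three
    (by rw [simplestCubicPoly_natDegree]; norm_num) (simplestCubicPoly_natDegree a).le]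
  refine Multiset.eq_zero_of_forall_notMem fun k hk => ?_
  have h := (mem_roots'.1 hk).2
  simp only [simplestCubicPoly, IsRoot.def, eval_sub, eval_mul, eval_pow, eval_X, eval_C,
    eval_one] at h
  have hu : IsUnit k := IsUnit.of_mul_eq_one (k ^ 2 - a * k - (a + 3)) (by linear_combination h)
  rcases Int.isUnit_iff.1 hu with rfl | rfl
  · lia
  · lia

lemma minpoly_eq_simplestCubicPoly {a : ℤ} {K : Type} [Field K] [NumberField K]
    {ρ : K} (hρ : ρ ^ 3 - a * ρ ^ 2 - (a + 3) * ρ - 1 = 0) :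
    minpoly ℚ ρ = (simplestCubicPoly a).map (algebraMap ℤ ℚ) := by
  refine (minpoly.eq_of_irreducible_of_monic ?_ ?_ ((simplestCubicPoly_monic a).map _)).symm
  · exact ((simplestCubicPoly_monic a).irreducible_iff_irreducible_map_fraction_map).1
      (simplestCubicPoly_irreducible a)
  · simpa [simplestCubicPoly, map_ofNat] using hρ

/-- The three real embeddings of a simplest cubic field, and the norm in terms of them. -/
lemma exists_embeddings {a : ℤ} {K : Type} [Field K] [NumberField K] {ρ : K}
    (hρ : ρ ^ 3 - a * ρ ^ 2 - (a + 3) * ρ - 1 = 0) (htop : IntermediateField.adjoin ℚ {ρ} = ⊤)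
    {t : Fin 3 → ℝ} (ht : ∀ i, t i ^ 3 - a * t i ^ 2 - (a + 3) * t i - 1 = 0)
    (hinj : Function.Injective t) :
    ∃ φ : Fin 3 → K →ₐ[ℚ] ℝ, (∀ i, φ i ρ = t i) ∧
      ∀ z, ((Algebra.norm ℚ z : ℚ) : ℝ) = ∏ i, φ i z := by
  have hρint : IsIntegral ℚ ρ := Algebra.IsIntegral.isIntegral ρ
  set pb : PowerBasis ℚ K := (IntermediateField.adjoin.powerBasis hρint).map
    ((IntermediateField.equivOfEq htop).trans IntermediateField.topEquiv) with hpb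
  have hgen : pb.gen = ρ := by
    simp only [hpb, PowerBasis.map_gen, IntermediateField.adjoin.powerBasis_gen]
    rfl
  have hmin := minpoly_eq_simplestCubicPoly hρ
  have hroot : ∀ i, aeval (t i) (minpoly ℚ pb.gen) = 0 := by
    intro i
    rw [hgen, hmin]
    simpa [simplestCubicPoly, map_ofNat] using ht i
  set φ : Fin 3 → K →ₐ[ℚ] ℝ := fun i => pb.lift (t i) (hroot i) with hφ
  have hφρ : ∀ i, φ i ρ = t i := by
    intro i
    rw [← hgen]
    exact pb.lift_gen _ _
  refine ⟨φ, hφρ, fun z => ?_⟩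
  let ι : ℝ →ₐ[ℚ] ℂ := Complex.ofRealAm.restrictScalars ℚ
  let Φ : Fin 3 → K →ₐ[ℚ] ℂ := fun i => ι.comp (φ i)
  have hΦ : Function.Injective Φ := by
    intro i j hij
    apply hinj
    have h := DFunLike.congr_fun hij ρ
    simp only [Φ, AlgHom.comp_apply, hφρ] at h
    exact Complex.ofReal_injective h
  have hcard : Fintype.card (Fin 3) = Fintype.card (K →ₐ[ℚ] ℂ) := by
    rw [AlgHom.card, pb.finrank, ← pb.natDegree_minpoly, hgen, hmin,
      (simplestCubicPoly_monic a).natDegree_map, simplestCubicPoly_natDegree, Fintype.card_fin]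
  have hbij : Function.Bijective Φ := (Fintype.bijective_iff_injective_and_card Φ).2 ⟨hΦ, hcard⟩
  have h := Algebra.norm_eq_prod_embeddings ℚ ℂ z
  rw [← (Equiv.ofBijective Φ hbij).prod_comp] at h
  apply Complex.ofReal_injective
  rw [Complex.ofReal_prod]
  simpa [Φ, ι] using h

lemma exists_integer_coords {a : ℤ} {K : Type} [Field K] {ρ : K}
    (hρ : ρ ^ 3 - a * ρ ^ 2 - (a + 3) * ρ - 1 = 0) {z : K} (hz : z ∈ Algebra.adjoin ℤ {ρ}) :
    ∃ u v w : ℤ, z = u + v * ρ + w * (a + 2 + a * ρ - ρ ^ 2) := by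
  induction hz using Algebra.adjoin_induction with
  | mem x hx =>
    rw [Set.mem_singleton_iff] at hx
    exact ⟨0, 1, 0, by simp [hx]⟩
  | algebraMap r => exact ⟨r, 0, 0, by simp⟩
  | add x y _ _ hx hy =>
    obtain ⟨u, v, w, rfl⟩ := hx
    obtain ⟨u', v', w', rfl⟩ := hy
    exact ⟨u + u', v + v', w + w', by push_cast; ring⟩
  | mul x y _ _ hx hy =>
    obtain ⟨u, v, w, rfl⟩ := hx
    obtain ⟨u', v', w', rfl⟩ := hy
    refine ⟨u * u' + (a + 2) * (v * v') - (v * w' + w * v') + 2 * (w * w'),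
      u * v' + v * u' + a * (v * v') - (v * w' + w * v') + w * w',
      u * w' + w * u' - v * v' + (a + 1) * (w * w'), ?_⟩
    push_cast
    linear_combination (-(v * w' + w * v' : K) + w * w' * (ρ - a)) * hρ

end Algebraic

section CoprimePairs

open Finset

lemma sum_inv_sq_le (n : ℕ) (hn : 2 ≤ n) :
    ∑ d ∈ Icc 2 n, (1 : ℝ) / (d : ℝ) ^ 2 ≤ 13 / 20 - 1 / ((n : ℝ) + 1 / 2) := by
  induction n, hn using Nat.le_induction with
  | base => norm_num
  | succ n hn ih =>
    rw [sum_Icc_succ_top (by lia)]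
    have h : (1 : ℝ) / ((n + 1 : ℕ) : ℝ) ^ 2 ≤
        1 / ((n : ℝ) + 1 / 2) - 1 / (((n + 1 : ℕ) : ℝ) + 1 / 2) := by
      push_cast
      rw [div_sub_div _ _ (by positivity) (by positivity), div_le_div_iff₀ (by positivity)
        (by positivity)]
      ring_nf
      nlinarith
    linarith

lemma card_not_coprime_le (V W : ℕ) :
    (#{z ∈ Ioc 0 V ×ˢ Ioc 0 W | ¬ Nat.Coprime z.1 z.2} : ℝ) ≤ 13 / 20 * (V * W) := by
  have hsub : {z ∈ Ioc 0 V ×ˢ Ioc 0 W | ¬ Nat.Coprime z.1 z.2} ⊆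
      (Icc 2 (V + 2)).biUnion fun d => {v ∈ Ioc 0 V | d ∣ v} ×ˢ {w ∈ Ioc 0 W | d ∣ w} := by
    rintro ⟨v, w⟩ hz
    simp only [mem_filter, mem_product, mem_Ioc] at hz
    obtain ⟨⟨⟨hv0, hv⟩, hw0, hw⟩, hc⟩ := hz
    simp only [mem_biUnion, mem_product, mem_filter, mem_Icc, mem_Ioc]
    have hpos : 0 < v.gcd w := Nat.gcd_pos_of_pos_left _ hv0
    have hle : v.gcd w ≤ v := Nat.gcd_le_left _ hv0
    have hne : v.gcd w ≠ 1 := hc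
    exact ⟨v.gcd w, ⟨by lia, by lia⟩, ⟨⟨hv0, hv⟩, Nat.gcd_dvd_left v w⟩, ⟨hw0, hw⟩,
      Nat.gcd_dvd_right v w⟩
  have hcard := (card_le_card hsub).trans card_biUnion_le
  calc (#{z ∈ Ioc 0 V ×ˢ Ioc 0 W | ¬ Nat.Coprime z.1 z.2} : ℝ)
      ≤ ((∑ d ∈ Icc 2 (V + 2), (V / d) * (W / d) : ℕ) : ℝ) := by
        simp only [card_product, Nat.Ioc_filter_dvd_card_eq_div] at hcard
        exact_mod_cast hcard
    _ ≤ ∑ d ∈ Icc 2 (V + 2), (V * W : ℝ) * (1 / (d : ℝ) ^ 2) := by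
        push_cast
        refine sum_le_sum fun d hd => ?_
        calc ((V / d : ℕ) : ℝ) * ((W / d : ℕ) : ℝ) ≤ (V / d) * (W / d) :=
              mul_le_mul Nat.cast_div_le Nat.cast_div_le (by positivity) (by positivity)
          _ = _ := by ring
    _ = (V * W) * ∑ d ∈ Icc 2 (V + 2), 1 / (d : ℝ) ^ 2 := by rw [mul_sum]
    _ ≤ (V * W) * (13 / 20) := by
        have h := sum_inv_sq_le (V + 2) (by lia)
        have h' : (0 : ℝ) ≤ 1 / (((V + 2 : ℕ) : ℝ) + 1 / 2) := by positivity
        gcongr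
        linarith
    _ = _ := by ring

lemma card_coprime_block_ge (n k : ℕ) :
    (n * k : ℝ) ≤ #{z ∈ Ioc n (8 * n) ×ˢ Ioc k (8 * k) | Nat.Coprime z.1 z.2} := by
  have hsub : Ioc n (8 * n) ×ˢ Ioc k (8 * k) ⊆
      {z ∈ Ioc n (8 * n) ×ˢ Ioc k (8 * k) | Nat.Coprime z.1 z.2} ∪
      {z ∈ Ioc 0 (8 * n) ×ˢ Ioc 0 (8 * k) | ¬ Nat.Coprime z.1 z.2} := by
    rintro ⟨v, w⟩ hz
    simp only [mem_union, mem_filter, mem_product, mem_Ioc] at hz ⊢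
    by_cases h : v.Coprime w
    · exact Or.inl ⟨hz, h⟩
    · exact Or.inr ⟨⟨⟨by lia, by lia⟩, by lia, by lia⟩, h⟩
  have h1 := (card_le_card hsub).trans (card_union_le _ _)
  have h2 := card_not_coprime_le (8 * n) (8 * k)
  have h3 : #(Ioc n (8 * n) ×ˢ Ioc k (8 * k)) = 49 * (n * k) := by
    rw [card_product, Nat.card_Ioc, Nat.card_Ioc, show 8 * n - n = 7 * n by lia,
      show 8 * k - k = 7 * k by lia]
    ring
  rw [h3] at h1
  have h1' : (49 * (n * k) : ℝ) ≤
      #{z ∈ Ioc n (8 * n) ×ˢ Ioc k (8 * k) | Nat.Coprime z.1 z.2} +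
      #{z ∈ Ioc 0 (8 * n) ×ˢ Ioc 0 (8 * k) | ¬ Nat.Coprime z.1 z.2} := by exact_mod_cast h1
  push_cast at h2
  have h4 : (0 : ℝ) ≤ n * k := by positivity
  nlinarith

lemma sum_coprime_block_ge {n k : ℕ} (hn : 0 < n) (hk : 0 < k) :
    (1 / 64 : ℝ) ≤ ∑ v ∈ Ioc n (8 * n), ∑ w ∈ Ioc k (8 * k),
      if Nat.Coprime v w then (1 : ℝ) / (v * w) else 0 := by
  rw [← sum_product', ← sum_filter (fun z : ℕ × ℕ => Nat.Coprime z.1 z.2)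
    (fun z => (1 : ℝ) / (z.1 * z.2))]
  have hn' : (0 : ℝ) < n := by exact_mod_cast hn
  have hk' : (0 : ℝ) < k := by exact_mod_cast hk
  calc (1 / 64 : ℝ) = (n * k) * (1 / (64 * (n * k))) := by field_simp
    _ ≤ #{z ∈ Ioc n (8 * n) ×ˢ Ioc k (8 * k) | Nat.Coprime z.1 z.2} * (1 / (64 * (n * k))) := by
        gcongr
        exact card_coprime_block_ge n k
    _ ≤ _ := by
        rw [← nsmul_eq_mul]
        refine card_nsmul_le_sum _ _ _ ?_
        rintro ⟨v, w⟩ hz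
        simp only [mem_filter, mem_product, mem_Ioc] at hz
        obtain ⟨⟨⟨hv0, hv⟩, hw0, hw⟩, -⟩ := hz
        have hv0' : (0 : ℝ) < v := by exact_mod_cast (by lia : 0 < v)
        have hw0' : (0 : ℝ) < w := by exact_mod_cast (by lia : 0 < w)
        have hv' : (v : ℝ) ≤ 8 * n := by exact_mod_cast hv
        have hw' : (w : ℝ) ≤ 8 * k := by exact_mod_cast hw
        apply one_div_le_one_div_of_le (by positivity)
        calc (v * w : ℝ) ≤ (8 * n) * (8 * k) := by gcongr
          _ = _ := by ring

lemma sum_geometric_blocks_ge (g : ℕ → ℝ) (B : ℝ) {n : ℕ} (hn : 0 < n)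
    (hg : ∀ k, 0 < k → B ≤ ∑ v ∈ Ioc k (8 * k), g v) (m : ℕ) :
    m * B ≤ ∑ v ∈ Ioc n (8 ^ m * n), g v := by
  induction m with
  | zero => simp
  | succ m ih =>
    rw [← sum_Ioc_consecutive g (n := 8 ^ m * n) (Nat.le_mul_of_pos_left _ (by positivity))
      (Nat.mul_le_mul_right _ (Nat.pow_le_pow_right (by norm_num) (Nat.le_succ m))),
      show 8 ^ (m + 1) * n = 8 * (8 ^ m * n) by ring]
    have h := hg (8 ^ m * n) (by positivity)
    push_cast
    linarith

/-- Coprime pairs `(v, w)` with `w` in the first and `v` in the second of two adjacent ranges of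
`m` geometric blocks. -/
def coprimePairs (m n : ℕ) : Finset (ℕ × ℕ) :=
  {z ∈ Ioc (8 ^ m * n) (8 ^ m * (8 ^ m * n)) ×ˢ Ioc n (8 ^ m * n) | Nat.Coprime z.1 z.2}

lemma sum_coprimePairs_ge (m : ℕ) {n : ℕ} (hn : 0 < n) :
    (m : ℝ) ^ 2 / 64 ≤ ∑ z ∈ coprimePairs m n, (1 : ℝ) / (z.1 * z.2) := by
  rw [coprimePairs, sum_filter, sum_product, show (m : ℝ) ^ 2 / 64 = m * (m * (1 / 64)) by ring]
  refine sum_geometric_blocks_ge _ _ (by positivity) (fun k hk => ?_) m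
  rw [sum_comm]
  refine sum_geometric_blocks_ge _ _ hn (fun j hj => ?_) m
  rw [sum_comm]
  exact sum_coprime_block_ge hk hj

end CoprimePairs

section Estimates

/-- A lattice point with all conjugates bounded by `T` has small coordinates. -/
lemma coords_bound {r p q u v w T : ℝ} (hr : 9 < r) (hp0 : 0 < p) (hp : p < 1 / 9) (hq : 1 < q)
    (hq' : q < 10 / 9) (h1 : |u + v * r - w * q| ≤ T) (h2 : |u - v * p + w * r| ≤ T)
    (h3 : |u - v * q - w * p| ≤ T) :
    (|v| + |w|) * (r - 2) ≤ 4 * T ∧ |u| ≤ T + 2 * (|v| + |w|) := by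
  have e1 : v * (r + q) = (u + v * r - w * q) - (u - v * q - w * p) + w * (q - p) := by ring
  have e2 : w * (r + p) = (u - v * p + w * r) - (u - v * q - w * p) - v * (q - p) := by ring
  have hv : |v| * (r + q) ≤ 2 * T + |w| * (q - p) := by
    calc |v| * (r + q) = |v * (r + q)| := by rw [abs_mul, abs_of_pos (by linarith : 0 < r + q)]
      _ ≤ |u + v * r - w * q| + |u - v * q - w * p| + |w * (q - p)| := by
        rw [e1]; exact (abs_add_le _ _).trans (by gcongr; exact abs_sub _ _)
      _ ≤ _ := by rw [abs_mul, abs_of_pos (by linarith : 0 < q - p)]; linarith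
  have hw : |w| * (r + p) ≤ 2 * T + |v| * (q - p) := by
    calc |w| * (r + p) = |w * (r + p)| := by rw [abs_mul, abs_of_pos (by linarith : 0 < r + p)]
      _ ≤ |u - v * p + w * r| + |u - v * q - w * p| + |v * (q - p)| := by
        rw [e2]; exact (abs_sub _ _).trans (by gcongr; exact abs_sub _ _)
      _ ≤ _ := by rw [abs_mul, abs_of_pos (by linarith : 0 < q - p)]; linarith
  have hv0 := abs_nonneg v
  have hw0 := abs_nonneg w
  refine ⟨by nlinarith, ?_⟩
  calc |u| = |(u - v * q - w * p) + v * q + w * p| := by congr 1; ring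
    _ ≤ |u - v * q - w * p| + |v * q| + |w * p| :=
      (abs_add_le _ _).trans (by gcongr; exact abs_add_le _ _)
    _ ≤ T + |v| * 2 + |w| * 2 := by
      rw [abs_mul, abs_mul, abs_of_pos hp0, abs_of_pos (by linarith : 0 < q)]
      gcongr <;> linarith
    _ = _ := by ring

/-- The size of the conjugates of the lattice points that are counted. -/
lemma conjugates_bound {r p q u v w n D x : ℝ} (hr : 9 < r) (hp0 : 0 < p) (hp : p < 1 / 9)
    (hq : 1 < q) (hq' : q < 10 / 9) (hn : 1 ≤ n) (hDr : D ^ 2 ≤ 64 * r)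
    (hx : x ≤ (n * r) ^ 3) (hw1 : n ≤ w) (hw2 : w ≤ D * n) (hv1 : D * n ≤ v)
    (hv2 : v ≤ D * (D * n)) (h0 : 0 < u - v * q - w * p)
    (hY : u - v * q - w * p ≤ x / (400 * (v * w) * r ^ 2)) :
    (D * n * r ≤ u + v * r - w * q ∧ u + v * r - w * q ≤ 3 * D * (D * n * r)) ∧
    (n * r ≤ u - v * p + w * r ∧ u - v * p + w * r ≤ 131 * D * (n * r)) ∧
    (u + v * r - w * q) * (u - v * p + w * r) * (u - v * q - w * p) ≤ x := by
  have hw0 : 0 < w := by linarith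
  have hwv : w ≤ v := hw2.trans hv1
  have hv0 : 0 < v := by linarith
  have hnv : n ≤ v := hw1.trans hwv
  have hr0 : 0 < r := by linarith
  have hYn : u - v * q - w * p ≤ n * r := by
    refine hY.trans ?_
    rw [div_le_iff₀ (by positivity)]
    have h : n * n ≤ v * w := mul_le_mul hnv hw1 (by linarith) hv0.le
    calc x ≤ (n * r) ^ 3 := hx
      _ = n * r * ((n * n) * r ^ 2) := by ring
      _ ≤ n * r * ((400 * (v * w)) * r ^ 2) := by
        have h' : n * n ≤ 400 * (v * w) := by nlinarith [mul_pos hv0 hw0]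
        gcongr n * r * (?_ * r ^ 2)
  have l1 : v * r ≤ u + v * r - w * q := by nlinarith
  have u1 : u + v * r - w * q ≤ 3 * (v * r) := by nlinarith
  have l2 : w * r ≤ u - v * p + w * r := by nlinarith
  have hvw : v ≤ 64 * r * w := by
    calc v ≤ D * (D * n) := hv2
      _ = D ^ 2 * n := by ring
      _ ≤ 64 * r * w := by gcongr
  have u2 : u - v * p + w * r ≤ 131 * (w * r) := by nlinarith
  refine ⟨⟨?_, ?_⟩, ⟨?_, ?_⟩, ?_⟩
  · exact le_trans (by gcongr) l1
  · refine u1.trans ?_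
    calc 3 * (v * r) ≤ 3 * (D * (D * n) * r) := by gcongr
      _ = _ := by ring
  · exact le_trans (by gcongr) l2
  · refine u2.trans ?_
    calc 131 * (w * r) ≤ 131 * (D * n * r) := by gcongr
      _ = _ := by ring
  · calc (u + v * r - w * q) * (u - v * p + w * r) * (u - v * q - w * p)
        ≤ (3 * (v * r)) * (131 * (w * r)) * (x / (400 * (v * w) * r ^ 2)) := by
          have : 0 ≤ u + v * r - w * q := le_trans (by positivity) l1
          have : 0 ≤ u - v * p + w * r := le_trans (by positivity) l2
          gcongr
      _ = 393 / 400 * x := by field_simp; ring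
      _ ≤ x := by
          have : 0 ≤ x := by
            by_contra! h
            have := div_neg_of_neg_of_pos h (by positivity : 0 < 400 * (v * w) * r ^ 2)
            linarith
          linarith

/-- The coordinates of a totally positive unit whose conjugates are small compared with `a` are
bounded by an absolute constant. -/
lemma unit_coords_bound {a r p q D : ℝ} {u v w : ℤ} (hr : 9 < r) (har : a + 1 < r) (hp0 : 0 < p)
    (hp : p < 1 / 9) (hq : 1 < q) (hq' : q < 10 / 9) (hD : 1 ≤ D) (hDa : D ^ 3 ≤ 512 * a)
    (h10 : 0 < u + v * r - w * q) (h20 : 0 < u - v * p + w * r) (h30 : 0 < u - v * q - w * p)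
    (hprod : (u + v * r - w * q) * (u - v * p + w * r) * (u - v * q - w * p) = 1)
    (h1 : u + v * r - w * q ≤ 400 * D ^ 2) (h2 : u - v * p + w * r ≤ 400 * D ^ 2)
    (h3 : u - v * q - w * p ≤ 400 * D ^ 2) :
    |u| ≤ 2 * 10 ^ 15 ∧ |v| ≤ 2 * 10 ^ 15 ∧ |w| ≤ 2 * 10 ^ 15 := by
  obtain ⟨hvw, hu⟩ := coords_bound (T := 400 * D ^ 2) hr hp0 hp hq hq' (by rwa [abs_of_pos h10])
    (by rwa [abs_of_pos h20]) (by rwa [abs_of_pos h30])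
  by_cases h0 : |v| + |w| = 0
  · have hv := abs_nonneg v
    have hw := abs_nonneg w
    obtain rfl : v = 0 := abs_eq_zero.1 (by lia)
    obtain rfl : w = 0 := abs_eq_zero.1 (by lia)
    have hu1 : u * (u * u) = 1 := by
      have : ((u * (u * u) : ℤ) : ℝ) = 1 := by
        push_cast
        rw [← hprod]
        push_cast
        ring
      exact_mod_cast this
    rcases Int.isUnit_iff.1 (IsUnit.of_mul_eq_one _ hu1) with rfl | rfl <;> norm_num
  · have h1' : (1 : ℝ) ≤ |(v : ℝ)| + |(w : ℝ)| := by
      have : 1 ≤ |v| + |w| := by have := abs_nonneg v; have := abs_nonneg w; lia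
      exact_mod_cast this
    have hv := abs_nonneg (v : ℝ)
    have hw := abs_nonneg (w : ℝ)
    have hD2 : D ≤ 512 * 1601 := by
      have h4 : r - 2 ≤ 1600 * D ^ 2 := by nlinarith
      have h5 : D ^ 2 * D ≤ D ^ 2 * (512 * 1601) := by nlinarith
      exact le_of_mul_le_mul_left h5 (by positivity)
    have hDsq : D ^ 2 ≤ (512 * 1601) ^ 2 := by gcongr
    have hsum : |(v : ℝ)| + |(w : ℝ)| ≤ 230 * D ^ 2 := by nlinarith
    refine ⟨?_, ?_, ?_⟩
    · have : |(u : ℝ)| ≤ 2 * 10 ^ 15 := by linarith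
      exact_mod_cast this
    · have : |(v : ℝ)| ≤ 2 * 10 ^ 15 := by linarith
      exact_mod_cast this
    · have : |(w : ℝ)| ≤ 2 * 10 ^ 15 := by linarith
      exact_mod_cast this

/-- Index set for the lattice points that are counted: a coprime pair `(v, w)` and the position
of the remaining coordinate in an interval of length `x / (400 v w r²)`. -/
noncomputable def pointIndex (m n : ℕ) (x r : ℝ) : Finset (Σ _ : ℕ × ℕ, ℕ) :=
  (coprimePairs m n).sigma fun z => Finset.Icc 1 ⌊x / (400 * (z.1 * z.2) * r ^ 2)⌋₊

lemma card_pointIndex_ge {m n : ℕ} {x r : ℝ} (hn : 0 < n) (hr : 0 < r)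
    (hx : 400 * 512 ^ m * (n * r) ^ 2 ≤ x) :
    (m : ℝ) ^ 2 / 64 * (x / (800 * r ^ 2)) ≤ (pointIndex m n x r).card := by
  have hn' : (0 : ℝ) < n := by exact_mod_cast hn
  have hx0 : 0 < x := lt_of_lt_of_le (by positivity) hx
  rw [pointIndex, Finset.card_sigma]
  push_cast
  calc (m : ℝ) ^ 2 / 64 * (x / (800 * r ^ 2))
      ≤ (∑ z ∈ coprimePairs m n, (1 : ℝ) / (z.1 * z.2)) * (x / (800 * r ^ 2)) := by
        gcongr
        exact sum_coprimePairs_ge m hn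
    _ = ∑ z ∈ coprimePairs m n, x / (400 * (z.1 * z.2) * r ^ 2) / 2 := by
        rw [Finset.sum_mul]
        refine Finset.sum_congr rfl fun z _ => ?_
        rw [div_mul_div_comm, div_div, one_mul]
        congr 1
        ring
    _ ≤ _ := by
        refine Finset.sum_le_sum ?_
        rintro ⟨v, w⟩ hz
        simp only [coprimePairs, Finset.mem_filter, Finset.mem_product, Finset.mem_Ioc] at hz
        obtain ⟨⟨⟨hv0, hv⟩, hw0, hw⟩, -⟩ := hz
        have hv0' : (0 : ℝ) < v := by exact_mod_cast (by lia : 0 < v)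
        have hw0' : (0 : ℝ) < w := by exact_mod_cast (by lia : 0 < w)
        have hv' : (v : ℝ) ≤ 8 ^ m * (8 ^ m * n) := by exact_mod_cast hv
        have hw' : (w : ℝ) ≤ 8 ^ m * n := by exact_mod_cast hw
        have hY : 1 ≤ x / (400 * ((v : ℝ) * w) * r ^ 2) := by
          rw [le_div_iff₀ (by positivity)]
          calc 1 * (400 * ((v : ℝ) * w) * r ^ 2)
              ≤ 1 * (400 * ((8 ^ m * (8 ^ m * n)) * (8 ^ m * n)) * r ^ 2) := by gcongr
            _ = 400 * (8 ^ m) ^ 3 * (n * r) ^ 2 := by ring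
            _ ≤ x := by rwa [← pow_mul, mul_comm m 3, pow_mul, show (8 : ℝ) ^ 3 = 512 by norm_num]
        simp only [Nat.card_Icc, add_tsub_cancel_right]
        have h1 := Nat.sub_one_lt_floor (x / (400 * ((v : ℝ) * w) * r ^ 2))
        have h2 : (1 : ℝ) ≤ ⌊x / (400 * ((v : ℝ) * w) * r ^ 2)⌋₊ := by
          exact_mod_cast Nat.one_le_floor_iff _ |>.2 hY
        linarith

end Estimates

section Counting

open Finset

/-- Numbers with product one that are quotients within two given ranges are bounded. -/
lemma quotient_bound {P Q D y₁ y₂ e₁ e₂ e₃ : ℝ} (hD1 : 1 ≤ D) (hP : 0 < P) (hQ : 0 < Q)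
    (l1 : P ≤ y₁) (u1 : y₁ ≤ 3 * D * P) (l2 : Q ≤ y₂) (u2 : y₂ ≤ 131 * D * Q)
    (l1' : P ≤ y₁ * e₁) (u1' : y₁ * e₁ ≤ 3 * D * P) (l2' : Q ≤ y₂ * e₂)
    (u2' : y₂ * e₂ ≤ 131 * D * Q) (p1 : 0 < e₁) (p2 : 0 < e₂) (p3 : 0 < e₃)
    (hprod : e₁ * e₂ * e₃ = 1) :
    e₁ ≤ 400 * D ^ 2 ∧ e₂ ≤ 400 * D ^ 2 ∧ e₃ ≤ 400 * D ^ 2 := by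
  have b1 : e₁ ≤ 3 * D := by
    refine le_of_mul_le_mul_left ?_ hP
    nlinarith
  have b2 : e₂ ≤ 131 * D := by
    refine le_of_mul_le_mul_left ?_ hQ
    nlinarith
  have b1' : 1 ≤ 3 * D * e₁ := by
    refine le_of_mul_le_mul_left ?_ hP
    nlinarith
  have b2' : 1 ≤ 131 * D * e₂ := by
    refine le_of_mul_le_mul_left ?_ hQ
    nlinarith
  have b3 : e₃ ≤ 400 * D ^ 2 := by
    calc e₃ = 1 * 1 * e₃ := by ring
      _ ≤ (3 * D * e₁) * (131 * D * e₂) * e₃ := by gcongr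
      _ = 393 * D ^ 2 * (e₁ * e₂ * e₃) := by ring
      _ ≤ 400 * D ^ 2 := by rw [hprod]; nlinarith [sq_nonneg D]
  have b1f : e₁ ≤ 400 * D ^ 2 := by nlinarith
  have b2f : e₂ ≤ 400 * D ^ 2 := by nlinarith
  exact ⟨b1f, b2f, b3⟩

/-- In the ring of integers of a field with three real embeddings of simplest cubic shape, the
counted lattice points give at least their number, up to an absolute constant, of primitive
principal ideals. -/
lemma card_pointIndex_le {K : Type} [Field K] [NumberField K] {R Θ : 𝓞 K} {ψ₁ ψ₂ ψ₃ : 𝓞 K →+* ℝ}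
    {a r p q x : ℝ} {m n : ℕ} (hr : 9 < r) (har : a + 1 < r) (hp0 : 0 < p) (hp : p < 1 / 9)
    (hq : 1 < q) (hq' : q < 10 / 9) (hR₁ : ψ₁ R = r) (hR₂ : ψ₂ R = -p) (hR₃ : ψ₃ R = -q)
    (hΘ₁ : ψ₁ Θ = -q) (hΘ₂ : ψ₂ Θ = r) (hΘ₃ : ψ₃ Θ = -p)
    (hcoord : ∀ z : 𝓞 K, ∃ u v w : ℤ, z = u + v * R + w * Θ)
    (hnorm : ∀ z : 𝓞 K, ((Algebra.norm ℤ z : ℤ) : ℝ) = ψ₁ z * ψ₂ z * ψ₃ z)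
    {B : ℕ} (hB : 2 * 10 ^ 15 ≤ (B : ℤ)) (hn : 0 < n) (hm : 0 < m) (hma : 512 ^ m ≤ 512 * a) (hx : x ≤ (n * r) ^ 3) :
    (#(pointIndex m n x r) : ℝ) ≤ ((2 * B + 1) ^ 3 : ℕ) *
      (Set.ncard {I : Ideal (𝓞 K) | I ≠ ⊥ ∧ Submodule.IsPrincipal I ∧
        (Ideal.absNorm I : ℝ) ≤ x ∧
        ∀ n : ℤ, 2 ≤ n → ¬ I ≤ Ideal.span {(n : 𝓞 K)}} : ℝ) := by
  classical
  set T : Set (Ideal (𝓞 K)) := {I | I ≠ ⊥ ∧ Submodule.IsPrincipal I ∧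
    (Ideal.absNorm I : ℝ) ≤ x ∧ ∀ n : ℤ, 2 ≤ n → ¬ I ≤ Ideal.span {(n : 𝓞 K)}}
  set D : ℝ := 8 ^ m with hDdef
  have hn' : (1 : ℝ) ≤ n := by exact_mod_cast hn
  have hD8 : 8 ≤ D := le_self_pow₀ (by norm_num) hm.ne'
  have hD1 : 1 ≤ D := by linarith
  have hDa : D ^ 3 ≤ 512 * a := by
    rwa [hDdef, ← pow_mul, mul_comm m 3, pow_mul, show (8 : ℝ) ^ 3 = 512 by norm_num]
  have hDr : D ^ 2 ≤ 64 * r := by nlinarith [sq_nonneg D]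
  have e1 : ∀ u v w : ℤ, ψ₁ (u + v * R + w * Θ) = u + v * r - w * q := by
    intro u v w; simp only [map_add, map_mul, map_intCast, hR₁, hΘ₁]; ring
  have e2 : ∀ u v w : ℤ, ψ₂ (u + v * R + w * Θ) = u - v * p + w * r := by
    intro u v w; simp only [map_add, map_mul, map_intCast, hR₂, hΘ₂]; ring
  have e3 : ∀ u v w : ℤ, ψ₃ (u + v * R + w * Θ) = u - v * q - w * p := by
    intro u v w; simp only [map_add, map_mul, map_intCast, hR₃, hΘ₃]; ring
  have hzero : ∀ u v w : ℤ, (u + v * R + w * Θ : 𝓞 K) = 0 → u = 0 ∧ v = 0 ∧ w = 0 := by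
    intro u v w h
    have h1 := e1 u v w
    have h2 := e2 u v w
    have h3 := e3 u v w
    rw [h, map_zero] at h1 h2 h3
    obtain ⟨hvw, hu⟩ := coords_bound (T := 0) hr hp0 hp hq hq' (by rw [← h1, abs_zero])
      (by rw [← h2, abs_zero]) (by rw [← h3, abs_zero])
    have hv0 := abs_nonneg (v : ℝ)
    have hw0 := abs_nonneg (w : ℝ)
    have hv : |(v : ℝ)| = 0 := by nlinarith
    have hw : |(w : ℝ)| = 0 := by nlinarith
    have hu' : |(u : ℝ)| = 0 := le_antisymm (by linarith) (abs_nonneg _)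
    exact ⟨by exact_mod_cast abs_eq_zero.1 hu', by exact_mod_cast abs_eq_zero.1 hv,
      by exact_mod_cast abs_eq_zero.1 hw⟩
  have huniq : ∀ u v w u' v' w' : ℤ, (u + v * R + w * Θ : 𝓞 K) = u' + v' * R + w' * Θ →
      u = u' ∧ v = v' ∧ w = w' := by
    intro u v w u' v' w' h
    obtain ⟨h1, h2, h3⟩ := hzero (u - u') (v - v') (w - w') (by
      push_cast; linear_combination h)
    exact ⟨by lia, by lia, by lia⟩
  let U : (Σ _ : ℕ × ℕ, ℕ) → ℤ := fun s => ⌊(s.1.1 : ℝ) * q + s.1.2 * p⌋ + s.2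
  let A : (Σ _ : ℕ × ℕ, ℕ) → 𝓞 K := fun s =>
    (U s : 𝓞 K) + ((s.1.1 : ℤ) : 𝓞 K) * R + ((s.1.2 : ℤ) : 𝓞 K) * Θ
  have hAinj : Function.Injective A := by
    rintro ⟨⟨v, w⟩, k⟩ ⟨⟨v', w'⟩, k'⟩ h
    obtain ⟨h1, h2, h3⟩ := huniq _ _ _ _ _ _ h
    obtain rfl : v = v' := by simpa using h2
    obtain rfl : w = w' := by simpa using h3
    obtain rfl : k = k' := by simpa [U] using h1
    rfl
  have hbound : ∀ s ∈ pointIndex m n x r, (D * n * r ≤ ψ₁ (A s) ∧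
      ψ₁ (A s) ≤ 3 * D * (D * n * r)) ∧ (n * r ≤ ψ₂ (A s) ∧ ψ₂ (A s) ≤ 131 * D * (n * r)) ∧
      0 < ψ₃ (A s) ∧ ψ₁ (A s) * ψ₂ (A s) * ψ₃ (A s) ≤ x ∧ Nat.Coprime s.1.1 s.1.2 := by
    rintro ⟨⟨v, w⟩, k⟩ hs
    simp only [pointIndex, mem_sigma, coprimePairs, mem_filter, mem_product, mem_Ioc,
      mem_Icc] at hs
    obtain ⟨⟨⟨⟨hv0, hv⟩, hw0, hw⟩, hc⟩, hk1, hk⟩ := hs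
    have hk1' : (1 : ℝ) ≤ k := by exact_mod_cast hk1
    have hkY : (k : ℝ) ≤ x / (400 * ((v : ℝ) * w) * r ^ 2) := (Nat.le_floor_iff' (by lia)).1 hk
    have hfl := Int.floor_le ((v : ℝ) * q + w * p)
    have hlt := Int.lt_floor_add_one ((v : ℝ) * q + w * p)
    have hU : ((U ⟨(v, w), k⟩ : ℤ) : ℝ) = ⌊(v : ℝ) * q + w * p⌋ + k := by simp [U]
    have hα3 : 0 < ((U ⟨(v, w), k⟩ : ℤ) : ℝ) - v * q - w * p := by rw [hU]; linarith
    obtain ⟨b1, b2, b3⟩ := conjugates_bound (u := (U ⟨(v, w), k⟩ : ℤ)) (v := v) (w := w) (n := n)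
      (D := D) (x := x) hr hp0 hp hq hq' hn' hDr hx (by exact_mod_cast hw0.le)
      (by rw [hDdef]; exact_mod_cast hw) (by rw [hDdef]; exact_mod_cast hv0.le)
      (by rw [hDdef]; exact_mod_cast hv) hα3 (by rw [hU]; linarith)
    simp only [A]
    rw [e1, e2, e3]
    simp only [Int.cast_natCast]
    exact ⟨b1, b2, hα3, b3, hc⟩
  have hr0 : 0 < r := by linarith
  have hnr : 0 < n * r := by positivity
  have hDnr : 0 < D * n * r := by positivity
  have hmem : ∀ s ∈ pointIndex m n x r, Ideal.span {A s} ∈ T := by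
    intro s hs
    obtain ⟨⟨h1, -⟩, ⟨h2, -⟩, h3, hle, hc⟩ := hbound s hs
    refine ⟨?_, ⟨A s, rfl⟩, ?_, ?_⟩
    · rw [Ne, Ideal.span_singleton_eq_bot]
      intro h
      rw [h, map_zero] at h3
      exact h3.false
    · rw [Ideal.absNorm_span_singleton, Nat.cast_natAbs, Int.cast_abs, hnorm, abs_of_nonneg]
      · exact hle
      · have h1' := hDnr.trans_le h1
        have h2' := hnr.trans_le h2
        positivity
    · intro d hd hI
      rw [Ideal.span_singleton_le_span_singleton] at hI
      obtain ⟨y, hy⟩ := hI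
      obtain ⟨u, v, w, rfl⟩ := hcoord y
      obtain ⟨-, hv, hw⟩ := huniq _ _ _ (d * u) (d * v) (d * w)
        (hy.trans (by push_cast; ring))
      have hdvd : d.natAbs ∣ Nat.gcd s.1.1 s.1.2 := Nat.dvd_gcd
        (Int.natCast_dvd_natCast.1 (by rw [Int.natAbs_dvd]; exact ⟨v, hv⟩))
        (Int.natCast_dvd_natCast.1 (by rw [Int.natAbs_dvd]; exact ⟨w, hw⟩))
      rw [hc, Nat.dvd_one] at hdvd
      lia
  have hfin : T.Finite := by
    refine (Ideal.finite_setOfPred_absNorm_le ⌊x⌋₊).subset fun I hI => ?_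
    exact Nat.le_floor hI.2.2.1
  have himage : #((pointIndex m n x r).image fun s => Ideal.span {A s}) ≤ T.ncard := by
    rw [← Set.ncard_coe_finset]
    refine Set.ncard_le_ncard (fun I hI => ?_) hfin
    obtain ⟨s, hs, rfl⟩ := mem_image.1 (mem_coe.1 hI)
    exact hmem s hs
  let box : Finset (ℤ × ℤ × ℤ) := Icc (-B : ℤ) B ×ˢ Icc (-B : ℤ) B ×ˢ Icc (-B : ℤ) B
  have hboxcard : #box = (2 * B + 1) ^ 3 := by
    simp only [box, card_product, Int.card_Icc,
      show ((B : ℤ) + 1 - -B).toNat = 2 * B + 1 by lia]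
    ring
  have hassoc : ∀ s ∈ pointIndex m n x r, ∀ s₀ ∈ pointIndex m n x r,
      Ideal.span {A s} = Ideal.span {A s₀} →
      ∃ c ∈ box, A s = A s₀ * (c.1 + c.2.1 * R + c.2.2 * Θ) := by
    intro s hs s₀ hs₀ h
    obtain ⟨e, he⟩ := Ideal.span_singleton_eq_span_singleton.1 h.symm
    obtain ⟨u, v, w, huvw⟩ := hcoord (e : 𝓞 K)
    refine ⟨(u, v, w), ?_, by rw [← he, huvw]⟩
    obtain ⟨⟨l1, u1⟩, ⟨l2, u2⟩, l3, -, -⟩ := hbound s hs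
    obtain ⟨⟨l1', u1'⟩, ⟨l2', u2'⟩, l3', -, -⟩ := hbound s₀ hs₀
    have hmul : ∀ ψ : 𝓞 K →+* ℝ, ψ (A s₀) * ψ e = ψ (A s) := fun ψ => by rw [← map_mul, he]
    have m1 := hmul ψ₁
    have m2 := hmul ψ₂
    have m3 := hmul ψ₃
    have p1 : 0 < ψ₁ e := pos_of_mul_pos_right (m1 ▸ hDnr.trans_le l1) (hDnr.le.trans l1')
    have p2 : 0 < ψ₂ e := pos_of_mul_pos_right (m2 ▸ hnr.trans_le l2) (hnr.le.trans l2')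
    have p3 : 0 < ψ₃ e := pos_of_mul_pos_right (m3 ▸ l3) l3'.le
    have hprod : ψ₁ e * ψ₂ e * ψ₃ e = 1 := by
      have hpos : 0 < ψ₁ e * ψ₂ e * ψ₃ e := by positivity
      rw [← hnorm] at hpos ⊢
      rcases Int.isUnit_iff.1 (e.isUnit.map (Algebra.norm ℤ)) with h1 | h1
      · rw [h1, Int.cast_one]
      · rw [h1] at hpos
        norm_num at hpos
    obtain ⟨b1, b2, b3⟩ := quotient_bound hD1 hDnr hnr l1' u1' l2' u2' (m1.symm ▸ l1)
      (m1.symm ▸ u1) (m2.symm ▸ l2) (m2.symm ▸ u2) p1 p2 p3 hprod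
    rw [huvw, e1] at p1 b1
    rw [huvw, e2] at p2 b2
    rw [huvw, e3] at p3 b3
    rw [huvw, e1, e2, e3] at hprod
    obtain ⟨c1, c2, c3⟩ := unit_coords_bound hr har hp0 hp hq hq' hD1 hDa p1 p2 p3 hprod
      b1 b2 b3
    simp only [box, mem_product, mem_Icc]
    exact ⟨abs_le.1 (c1.trans hB), abs_le.1 (c2.trans hB), abs_le.1 (c3.trans hB)⟩
  have hfibre : ∀ I ∈ (pointIndex m n x r).image (fun s => Ideal.span {A s}),
      #{s ∈ pointIndex m n x r | Ideal.span {A s} = I} ≤ (2 * B + 1) ^ 3 := by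
    intro I hI
    obtain ⟨s₀, hs₀, rfl⟩ := mem_image.1 hI
    rw [← hboxcard]
    have hex : ∀ s, ∃ c, s ∈ pointIndex m n x r ∧ Ideal.span {A s} = Ideal.span {A s₀} →
        c ∈ box ∧ A s = A s₀ * (c.1 + c.2.1 * R + c.2.2 * Θ) := by
      intro s
      by_cases h : s ∈ pointIndex m n x r ∧ Ideal.span {A s} = Ideal.span {A s₀}
      · obtain ⟨c, hc, hc'⟩ := hassoc s h.1 s₀ hs₀ h.2
        exact ⟨c, fun _ => ⟨hc, hc'⟩⟩
      · exact ⟨0, fun h' => absurd h' h⟩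
    choose F hF using hex
    refine card_le_card_of_injOn F (fun s hs => ?_) (fun s hs t ht hst => hAinj ?_)
    · exact (hF s (mem_filter.1 (mem_coe.1 hs))).1
    · rw [(hF s (mem_filter.1 (mem_coe.1 hs))).2, (hF t (mem_filter.1 (mem_coe.1 ht))).2, hst]
  have hfinal := (card_le_mul_card_image _ _ hfibre).trans (Nat.mul_le_mul_left _ himage)
  exact_mod_cast hfinal

end Counting

lemma log_le_natLog {a : ℤ} (ha : 8 ≤ a) :
    Real.log a / 7 ≤ (Nat.log 512 a.toNat + 1 : ℕ) ∧
      (512 : ℝ) ^ (Nat.log 512 a.toNat + 1) ≤ 512 * a := by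
  have hcast : ((a.toNat : ℕ) : ℝ) = a := by
    have : ((a.toNat : ℕ) : ℤ) = a := Int.toNat_of_nonneg (by lia)
    exact_mod_cast congrArg (Int.cast : ℤ → ℝ) this
  have ha0 : (0 : ℝ) < a := by exact_mod_cast (by lia : 0 < a)
  constructor
  · have h1 : (a : ℝ) ≤ 512 ^ (Nat.log 512 a.toNat + 1) := by
      rw [← hcast]
      exact_mod_cast (Nat.lt_pow_succ_log_self (by norm_num) a.toNat).le
    have h2 := Real.log_le_log ha0 h1
    rw [Real.log_pow, show (512 : ℝ) = 2 ^ 9 by norm_num, Real.log_pow] at h2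
    have h3 := Real.log_two_lt_d9
    have h4 : ((9 : ℕ) : ℝ) * Real.log 2 ≤ 7 := by norm_num; linarith
    rw [div_le_iff₀ (by norm_num)]
    exact h2.trans (by gcongr)
  · have h1 : (512 : ℝ) ^ Nat.log 512 a.toNat ≤ a := by
      rw [← hcast]
      exact_mod_cast Nat.pow_log_le_self 512 (by lia)
    rw [pow_succ]
    linarith

/-- A natural number `n` with `(n r)³` comparable to `x`. -/
lemma exists_scale {a r x : ℝ} (ha : 8 ≤ a) (hr : 9 < r) (hra : r < a + 2)
    (hx : 819200 ^ 3 * a ^ 3 ≤ x) :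
    ∃ n : ℕ, 0 < n ∧ x ≤ (n * r) ^ 3 ∧ 400 * (512 * a) * (n * r) ^ 2 ≤ x := by
  have hx0 : 0 ≤ x := le_trans (by positivity) hx
  obtain ⟨X, hX0, rfl⟩ : ∃ X : ℝ, 0 ≤ X ∧ X ^ 3 = x :=
    ⟨x ^ ((1 : ℝ) / 3), by positivity, by
      rw [← Real.rpow_natCast, ← Real.rpow_mul hx0]; norm_num⟩
  have hX : 819200 * a ≤ X := by
    rw [← mul_pow] at hx
    exact le_of_pow_le_pow_left₀ (by norm_num) hX0 hx
  have hr0 : 0 < r := by linarith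
  have hXr : 0 < X / r := div_pos (by linarith) hr0
  have h1 : X ≤ ⌈X / r⌉₊ * r := (div_le_iff₀ hr0).1 (Nat.le_ceil _)
  have h2 : ⌈X / r⌉₊ * r ≤ 2 * X := by
    have h := Nat.ceil_lt_add_one hXr.le
    calc ⌈X / r⌉₊ * r ≤ (X / r + 1) * r := by gcongr
      _ = X + r := by field_simp
      _ ≤ 2 * X := by linarith
  refine ⟨⌈X / r⌉₊, Nat.ceil_pos.2 hXr, by gcongr, ?_⟩
  calc 400 * (512 * a) * (⌈X / r⌉₊ * r) ^ 2 ≤ 400 * (512 * a) * (2 * X) ^ 2 := by gcongr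
    _ = 819200 * a * X ^ 2 := by ring
    _ ≤ X * X ^ 2 := by gcongr
    _ = X ^ 3 := by ring

theorem stmt_19 :
    ∃ c c' : ℝ, 0 < c ∧ 0 < c' ∧
      ∀ (a : ℤ), 8 ≤ a →
      ∀ (K : Type) [Field K] [NumberField K] (σ : K →+* ℝ) (ρK : K),
        σ ρK = simplestCubicRoot a →
        IntermediateField.adjoin ℚ {ρK} = ⊤ →
        Algebra.adjoin ℤ {ρK} = integralClosure ℤ K →
        ∀ x : ℝ, c * (a : ℝ) ^ 3 ≤ x →
          c' * (Real.log a) ^ 2 * x / (a : ℝ) ^ 2 ≤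
            (Set.ncard {I : Ideal (RingOfIntegers K) |
                I ≠ ⊥ ∧ Submodule.IsPrincipal I ∧ (Ideal.absNorm I : ℝ) ≤ x ∧
                ∀ n : ℤ, 2 ≤ n → ¬ I ≤ Ideal.span {(n : RingOfIntegers K)}} : ℝ) := by
  obtain ⟨B, hB⟩ : ∃ B : ℕ, 2 * 10 ^ 15 ≤ (B : ℤ) := ⟨2 * 10 ^ 15, by norm_num⟩
  have hM0 : (0 : ℝ) < (((2 * B + 1) ^ 3 : ℕ) : ℝ) := by positivity
  set M : ℝ := (((2 * B + 1) ^ 3 : ℕ) : ℝ)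
  refine ⟨819200 ^ 3, 1 / (7 ^ 2 * 64 * 3200 * M), by norm_num, by positivity, ?_⟩
  intro a ha K _ _ σ ρ hσ htop hadj x hx
  obtain ⟨hroot, har, hra⟩ := simplestCubicRoot_spec ha
  set r := simplestCubicRoot a
  have ha' : (8 : ℝ) ≤ a := by exact_mod_cast ha
  have hr : 9 < r := by linarith
  have hr0 : 0 < r := by linarith
  have hρ : ρ ^ 3 - a * ρ ^ 2 - (a + 3) * ρ - 1 = 0 := by
    apply σ.injective
    simpa [hσ, map_ofNat] using hroot
  set p : ℝ := 1 / (1 + r) with hp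
  set q : ℝ := 1 + 1 / r with hq
  have hp0 : 0 < p := by positivity
  have hp9 : p < 1 / 9 := one_div_lt_one_div_of_lt (by norm_num) (by linarith)
  have hq1 : 1 < q := by
    have : 0 < 1 / r := by positivity
    linarith
  have hq9 : q < 10 / 9 := by
    have : 1 / r < 1 / 9 := one_div_lt_one_div_of_lt (by norm_num) hr
    linarith
  have hroot' : (a : ℝ) * (r ^ 2 + r) = r ^ 3 - 3 * r - 1 := by linear_combination -hroot
  have har' : (a : ℝ) = (r ^ 3 - 3 * r - 1) / (r ^ 2 + r) := by
    rw [eq_div_iff (by positivity), hroot']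
  obtain ⟨φ, hφ, hnorm⟩ := exists_embeddings (t := ![r, -p, -q]) hρ htop
    (by
      intro i
      fin_cases i
      · exact hroot
      · simp only [Fin.mk_one, Fin.isValue, Matrix.cons_val_one, Matrix.cons_val_zero, har', hp]
        field_simp
        ring
      · simp only [Fin.reduceFinMk, Matrix.cons_val, har', hq]
        field_simp
        ring)
    (by
      intro i j hij
      fin_cases i <;> fin_cases j <;> first | rfl | (simp at hij; linarith))
  have hφ0 : φ 0 ρ = r := hφ 0
  have hφ1 : φ 1 ρ = -p := hφ 1
  have hφ2 : φ 2 ρ = -q := hφ 2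
  have hρint : IsIntegral ℤ ρ := by
    have : ρ ∈ integralClosure ℤ K := hadj ▸ Algebra.self_mem_adjoin_singleton ℤ ρ
    exact this
  let R : 𝓞 K := ⟨ρ, hρint⟩
  let Θ : 𝓞 K := a + 2 + a * R - R ^ 2
  let ψ : Fin 3 → 𝓞 K →+* ℝ := fun i => (φ i : K →+* ℝ).comp (algebraMap (𝓞 K) K)
  have hψR : ∀ i, ψ i R = φ i ρ := fun _ => rfl
  have hψΘ : ∀ i, ψ i Θ = a + 2 + a * φ i ρ - φ i ρ ^ 2 := by
    intro i
    simp only [Θ, map_sub, map_add, map_mul, map_pow, map_intCast, map_ofNat, hψR]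
  obtain ⟨hlog, hpow⟩ := log_le_natLog ha
  obtain ⟨n, hn, hxn, hnx⟩ := exists_scale ha' hr hra hx
  set m := Nat.log 512 a.toNat + 1
  have hupper := card_pointIndex_le (ψ₁ := ψ 0) (ψ₂ := ψ 1) (ψ₃ := ψ 2) (R := R) (Θ := Θ)
    (a := a) (r := r) (p := p) (q := q) (x := x) (m := m) (n := n) hr har hp0 hp9 hq1 hq9
    (by rw [hψR, hφ0]) (by rw [hψR, hφ1]) (by rw [hψR, hφ2])
    (by rw [hψΘ, hφ0, har', hq]; field_simp; ring) (by rw [hψΘ, hφ1, har', hp]; field_simp; ring)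
    (by rw [hψΘ, hφ2, har', hp, hq]; field_simp; ring)
    (by
      intro z
      have hz : (z : K) ∈ Algebra.adjoin ℤ {ρ} := hadj ▸ z.2
      obtain ⟨u, v, w, h⟩ := exists_integer_coords hρ hz
      refine ⟨u, v, w, RingOfIntegers.ext ?_⟩
      rw [h]
      simp only [Θ, map_sub, map_add, map_mul, map_pow, map_intCast, map_ofNat]
      rfl)
    (by
      intro z
      have h := hnorm (z : K)
      rw [← Algebra.coe_norm_int, Fin.prod_univ_three] at h
      exact_mod_cast h)
    hB hn (Nat.succ_pos _) hpow hxn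
  have hlower := card_pointIndex_ge (m := m) hn hr0 (x := x) (le_trans (by gcongr) hnx)
  have hx0 : 0 ≤ x := le_trans (by positivity) hx
  have hlog0 : 0 ≤ Real.log a := Real.log_nonneg (by linarith)
  refine le_of_mul_le_mul_left (le_trans ?_ (hlower.trans hupper)) hM0
  calc M * (1 / (7 ^ 2 * 64 * 3200 * M) * Real.log a ^ 2 * x / (a : ℝ) ^ 2)
      = (Real.log a / 7) ^ 2 / 64 * (x / (800 * (2 * a) ^ 2)) := by field_simp; ring
    _ ≤ (m : ℝ) ^ 2 / 64 * (x / (800 * r ^ 2)) := by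
        gcongr
        linarith
end
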